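/- arXiv:2112.07739 — 3 statements merged into one kernel-verified Lean document; each statement's English description precedes it below -/
import Mathlib

section
/- Let n ∈ ℕ₀ and set α = −(2n−1). Then the coefficients Z_N satisfy Z_N = 4^{n−1}·|A_n|·n!·N^{−(n+1)}·4^N·(1 + o(1)) as N → ∞; moreover (−1)^n·A_n = |A_n|, i.e. the sign of A_n is (−1)^n. -/
open Filter

/-- The functions `X_m` defined by the recursion `X₀(g) = 0`, `X_{m+1}(g) = g / (1 - X_m(g))`
(so that `X₁(g) = g`). -/
noncomputable def X : ℕ → ℝ → ℝ
  | 0, _ => 0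
  | m + 1, g => g / (1 - X m g)

/-- The numbers `A_k`, defined by the Laurent expansion
`1/(cosh(2t) − 1) = (1/(2t²))·[1 + Σ_{k≥1} A_k (2t)^{2k}]` for `0 < |t| < π`, with `A₀ = 1`. -/
def IsLaurentA (A : ℕ → ℝ) : Prop :=
  A 0 = 1 ∧
  ∀ t : ℝ, t ≠ 0 → |t| < Real.pi →
    HasSum (fun k : ℕ => A (k + 1) * (2 * t) ^ (2 * (k + 1)))
      (2 * t ^ 2 / (Real.cosh (2 * t) - 1) - 1)

/-- `Z` is the sequence of Taylor coefficients at `g = 0` of the generating function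
`W_α(g) = Σ_{m≥1} m^α (X_{m+1}(g) − X_m(g))`. -/
def IsCoeffSeq (α : ℝ) (Z : ℕ → ℝ) : Prop :=
  ∀ g : ℝ, 0 < g → g < 1 / 4 →
    HasSum (fun N : ℕ => Z N * g ^ N)
      (∑' m : ℕ, ((m : ℝ) + 1) ^ α * (X (m + 2) g - X (m + 1) g))

open Topology

lemma HasSum.congr_both {ι M : Type*} [AddCommMonoid M] [TopologicalSpace M] {f f' : ι → M}
    {a a' : M} (h : HasSum f' a') (hf : f = f')
    (ha : a = a') : HasSum f a := by
  rw [hf, ha]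
  exact h

/-- A real power series that sums to zero on a right neighbourhood of `0` has zero coefficients. -/
lemma coeff_eq_zero_of_hasSum_zero {d : ℕ → ℝ} {r : ℝ} (hr : 0 < r)
    (h : ∀ g : ℝ, 0 < g → g < r → HasSum (fun N : ℕ => d N * g ^ N) 0) (N : ℕ) : d N = 0 := by
  induction N using Nat.strong_induction_on with
  | _ k ih =>
  have hshift : ∀ g : ℝ, 0 < g → g < r → HasSum (fun N : ℕ => d (N + k) * g ^ N) 0 := by
    intro g hg hgr
    have h1 := (hasSum_nat_add_iff' k).2 (h g hg hgr)
    rw [Finset.sum_eq_zero (fun i hi => by rw [ih i (Finset.mem_range.1 hi), zero_mul]),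
      sub_zero] at h1
    have h2 := h1.mul_left ((g ^ k)⁻¹)
    rw [mul_zero] at h2
    refine HasSum.congr_both h2 (funext fun N => ?_) rfl
    rw [pow_add]
    field_simp
  have hr2 : 0 < r / 2 := by linarith
  have hs : Summable fun N : ℕ => |d (N + k)| * (r / 2) ^ N := by
    have := (hshift (r / 2) hr2 (by linarith)).summable.abs
    simpa [abs_mul, abs_pow, abs_of_pos hr2] using this
  have ht : Tendsto (fun g : ℝ => ∑' N : ℕ, d (N + k) * g ^ N) (𝓝[>] 0)
      (𝓝 (∑' N : ℕ, d (N + k) * (0 : ℝ) ^ N)) := by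
    refine tendsto_tsum_of_dominated_convergence hs (fun N => ?_) ?_
    · exact (Continuous.tendsto (by fun_prop) 0).mono_left nhdsWithin_le_nhds
    · filter_upwards [Ioo_mem_nhdsGT hr2] with g hg N
      rw [norm_mul, norm_pow, Real.norm_eq_abs, Real.norm_eq_abs, abs_of_pos hg.1]
      gcongr
      exact hg.1.le
      exact hg.2.le
  have h0 : Tendsto (fun g : ℝ => ∑' N : ℕ, d (N + k) * g ^ N) (𝓝[>] 0) (𝓝 0) := by
    refine tendsto_const_nhds.congr' ?_
    filter_upwards [Ioo_mem_nhdsGT hr] with g hg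
    exact (hshift g hg.1 hg.2).tsum_eq.symm
  have := tendsto_nhds_unique ht h0
  rw [tsum_eq_single 0 (fun N hN => by simp [hN])] at this
  simpa using this

lemma exists_uniformizer {g : ℝ} (hg : 0 < g) (hg' : g < 1 / 4) :
    ∃ q : ℝ, 0 < q ∧ q < 1 ∧ g = q / (1 + q) ^ 2 := by
  have h1 : 0 < 1 - 4 * g := by linarith
  have hs := Real.sq_sqrt h1.le
  have hs0 := Real.sqrt_pos.2 h1
  set s := √(1 - 4 * g)
  have hs1 : s < 1 := by nlinarith
  refine ⟨(1 - s) / (1 + s), by apply div_pos <;> linarith, ?_, ?_⟩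
  · rw [div_lt_one (by linarith)]; linarith
  · have : g = (1 - s ^ 2) / 4 := by linarith
    rw [this]
    field_simp
    ring

lemma X_uniformizer {q : ℝ} (hq : 0 < q) (hq' : q < 1) (m : ℕ) :
    X m (q / (1 + q) ^ 2) = (q - q ^ (m + 1)) / ((1 + q) * (1 - q ^ (m + 1))) := by
  induction m with
  | zero => simp [X]
  | succ m ih =>
    have h1 : 0 < 1 - q ^ (m + 1) := by
      have : q ^ (m + 1) < 1 := pow_lt_one₀ hq.le hq' (Nat.succ_ne_zero m)
      linarith
    have h2 : 0 < 1 - q ^ (m + 2) := by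
      have : q ^ (m + 1 + 1) < 1 := pow_lt_one₀ hq.le hq' (Nat.succ_ne_zero (m + 1))
      linarith
    have h3 : 1 - X m (q / (1 + q) ^ 2) = (1 - q ^ (m + 2)) / ((1 + q) * (1 - q ^ (m + 1))) := by
      rw [ih]
      field_simp
      ring
    rw [X, h3]
    field_simp
    ring

/-- The `X_m(g)` are nondecreasing in `m`. -/
lemma X_le_X_succ {g : ℝ} (hg : 0 < g) (hg' : g < 1 / 4) (m : ℕ) : X m g ≤ X (m + 1) g := by
  obtain ⟨q, hq, hq', rfl⟩ := exists_uniformizer hg hg'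
  rw [X_uniformizer hq hq', X_uniformizer hq hq']
  have h1 : 0 < 1 - q ^ (m + 1) := by
    have : q ^ (m + 1) < 1 := pow_lt_one₀ hq.le hq' (Nat.succ_ne_zero m)
    linarith
  have h2 : 0 < 1 - q ^ (m + 1 + 1) := by
    have : q ^ (m + 1 + 1) < 1 := pow_lt_one₀ hq.le hq' (Nat.succ_ne_zero (m + 1))
    linarith
  rw [div_le_div_iff₀ (by positivity) (by positivity)]
  have h3 : 0 ≤ q ^ (m + 1) * ((1 + q) * (1 - q) ^ 2) := by positivity
  have h4 : q ^ (m + 1 + 1) = q ^ (m + 1) * q := pow_succ _ _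
  rw [h4]
  nlinarith

/-- The summand `sin² x cos^{2p} x` in the trigonometric formula for the coefficients of `X_m`. -/
noncomputable def phi (p : ℕ) (x : ℝ) : ℝ := Real.sin x ^ 2 * Real.cos x ^ (2 * p)

/-- The mean of `phi p` over the `M` equidistant points `π j / M` of a period. -/
noncomputable def riem (M p : ℕ) : ℝ :=
  (∑ j ∈ Finset.range M, phi p (Real.pi * j / M)) / M

/-- The mean of `phi p` over a period. -/
noncomputable def mean (p : ℕ) : ℝ := (∫ x in (0 : ℝ)..Real.pi, phi p x) / Real.pi

lemma phi_nonneg (p : ℕ) (x : ℝ) : 0 ≤ phi p x :=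
  mul_nonneg (sq_nonneg _) (Even.pow_nonneg (even_two_mul p) _)

lemma riem_nonneg (M p : ℕ) : 0 ≤ riem M p :=
  div_nonneg (Finset.sum_nonneg fun _ _ => phi_nonneg _ _) (Nat.cast_nonneg _)

lemma sum_inv_one_sub_rootsOfUnity {M : ℕ} (hM : M ≠ 0) {ζ : ℂ} (hζ : IsPrimitiveRoot ζ M)
    {q : ℂ} (hq : q ^ M ≠ 1) :
    ∑ j ∈ Finset.range M, (1 - q * ζ ^ j)⁻¹ = M / (1 - q ^ M) := by
  have hq1 : 1 - q ^ M ≠ 0 := sub_ne_zero.2 hq.symm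
  have hterm : ∀ j, (1 - q * ζ ^ j)⁻¹ = (∑ k ∈ Finset.range M, (q * ζ ^ j) ^ k) / (1 - q ^ M) := by
    intro j
    have h1 := mul_neg_geom_sum (q * ζ ^ j) M
    have h2 : (q * ζ ^ j) ^ M = q ^ M := by
      rw [mul_pow, ← pow_mul, mul_comm j, pow_mul, hζ.pow_eq_one, one_pow, mul_one]
    rw [h2] at h1
    have h3 : 1 - q * ζ ^ j ≠ 0 := by
      intro h
      rw [h, zero_mul] at h1
      exact hq1 h1.symm
    rw [eq_div_iff hq1, inv_mul_eq_div, div_eq_iff h3, ← h1, mul_comm]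
  rw [Finset.sum_congr rfl fun j _ => hterm j, ← Finset.sum_div, Finset.sum_comm]
  congr 1
  rw [Finset.sum_eq_single 0]
  · simp
  · intro k hk hk0
    have hkM := Finset.mem_range.1 hk
    have : ∀ j, (q * ζ ^ j) ^ k = q ^ k * (ζ ^ k) ^ j := fun j => by
      rw [mul_pow, ← pow_mul, ← pow_mul, mul_comm j]
    rw [Finset.sum_congr rfl fun j _ => this j, ← Finset.mul_sum]
    have h1 := mul_neg_geom_sum (ζ ^ k) M
    rw [← pow_mul, mul_comm k, pow_mul, hζ.pow_eq_one, one_pow, sub_self] at h1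
    have h2 : 1 - ζ ^ k ≠ 0 := sub_ne_zero.2 (hζ.pow_ne_one_of_pos_of_lt hk0 hkM).symm
    rw [(mul_eq_zero.1 h1).resolve_left h2, mul_zero]
  · intro h
    exact absurd (Finset.mem_range.2 (Nat.pos_of_ne_zero hM)) h

lemma sum_poisson_re {M : ℕ} (hM : M ≠ 0) {q : ℝ} (hq : 0 < q) (hq' : q < 1) :
    ∑ j ∈ Finset.range M, (1 - q * Real.cos (2 * (Real.pi * j / M))) /
      (1 + q ^ 2 - 2 * q * Real.cos (2 * (Real.pi * j / M))) = M / (1 - q ^ M) := by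
  have hqM : q ^ M < 1 := pow_lt_one₀ hq.le hq' hM
  have h := sum_inv_one_sub_rootsOfUnity hM (Complex.isPrimitiveRoot_exp M hM) (q := (q : ℂ))
    (by exact_mod_cast hqM.ne)
  have h2 := congrArg Complex.re h
  rw [Complex.re_sum] at h2
  have h3 : ((M : ℂ) / (1 - (q : ℂ) ^ M)).re = M / (1 - q ^ M) := by
    rw [← Complex.ofReal_re (M / (1 - q ^ M))]
    push_cast
    rfl
  rw [h3] at h2
  rw [← h2]
  refine Finset.sum_congr rfl fun j _ => ?_
  have h4 : Complex.exp (2 * Real.pi * Complex.I / M) ^ j =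
      Complex.exp ((2 * (Real.pi * j / M) : ℝ) * Complex.I) := by
    rw [← Complex.exp_nat_mul]
    congr 1
    push_cast
    ring
  rw [h4]
  set x : ℝ := 2 * (Real.pi * j / M)
  rw [Complex.inv_re, Complex.normSq_apply]
  simp only [Complex.sub_re, Complex.one_re, Complex.mul_re, Complex.ofReal_re, Complex.ofReal_im,
    Complex.exp_ofReal_mul_I_re, Complex.exp_ofReal_mul_I_im, Complex.sub_im, Complex.one_im,
    Complex.mul_im, zero_mul, sub_zero, add_zero, zero_sub]
  congr 1
  linear_combination (-q ^ 2) * Real.sin_sq_add_cos_sq x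

/-- The Taylor expansion of `X_m`, with coefficients in trigonometric form. -/
lemma hasSum_X {g : ℝ} (hg : 0 < g) (hg' : g < 1 / 4) (m : ℕ) :
    HasSum (fun p : ℕ => 2 * 4 ^ p * riem (m + 1) p * g ^ (p + 1)) (X m g) := by
  obtain ⟨q, hq, hq', hgq⟩ := exists_uniformizer hg hg'
  have hM : (m + 1 : ℕ) ≠ 0 := Nat.succ_ne_zero m
  have hqM : q ^ (m + 1) < 1 := pow_lt_one₀ hq.le hq' hM
  have hterm : ∀ x : ℝ, HasSum (fun p : ℕ => 2 * 4 ^ p * phi p x * g ^ (p + 1))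
      (1 / 2 * (1 - (1 - q) / (1 + q) *
        (2 * ((1 - q * Real.cos (2 * x)) / (1 + q ^ 2 - 2 * q * Real.cos (2 * x))) - 1))) := by
    intro x
    have hc : Real.cos x ^ 2 ≤ 1 := Real.cos_sq_le_one x
    have hlt : 4 * g * Real.cos x ^ 2 < 1 := by nlinarith [sq_nonneg (Real.cos x)]
    have h1 := (hasSum_geometric_of_lt_one (by positivity) hlt).mul_left
      (2 * Real.sin x ^ 2 * g)
    refine HasSum.congr_both h1 ?_ ?_
    · funext p
      rw [phi, mul_pow, mul_pow, ← pow_mul]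
      ring
    · have hD : 0 < 1 + q ^ 2 - 2 * q * Real.cos (2 * x) := by
        nlinarith [Real.cos_le_one (2 * x), sq_nonneg (1 - q),
          mul_pos (sub_pos.2 hq') (sub_pos.2 hq')]
      have hD' : 1 - 4 * g * Real.cos x ^ 2 =
          (1 + q ^ 2 - 2 * q * Real.cos (2 * x)) / (1 + q) ^ 2 := by
        rw [hgq, Real.cos_two_mul]
        field_simp
        ring
      have hsin : Real.sin x ^ 2 = (1 - Real.cos (2 * x)) / 2 := by
        rw [Real.cos_two_mul, Real.sin_sq]
        ring
      rw [hD', hsin, hgq]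
      field_simp
      ring
  have hsum := (hasSum_sum (s := Finset.range (m + 1))
    (fun j _ => hterm (Real.pi * j / (m + 1 : ℕ)))).div_const ((m + 1 : ℕ) : ℝ)
  refine HasSum.congr_both hsum ?_ ?_
  · funext p
    rw [riem, ← Finset.sum_mul, ← Finset.mul_sum]
    ring
  · rw [← Finset.mul_sum, Finset.sum_sub_distrib, ← Finset.mul_sum, Finset.sum_sub_distrib,
      ← Finset.mul_sum, sum_poisson_re hM hq hq', hgq, X_uniformizer hq hq']
    simp only [Finset.sum_const, Finset.card_range, nsmul_eq_mul, mul_one]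
    have h1 : 1 - q ^ (m + 1) ≠ 0 := by linarith
    have h2 : ((m + 1 : ℕ) : ℝ) ≠ 0 := by exact_mod_cast hM
    field_simp
    ring

/-- Error bound for the trapezoidal rule on one interval, in terms of `∫ |f''|`. -/
lemma abs_trapezoid_error_le {f f' f'' : ℝ → ℝ} (hf : ∀ x, HasDerivAt f (f' x) x)
    (hf' : ∀ x, HasDerivAt f' (f'' x) x) (hc : Continuous f'') {a b : ℝ} (hab : a ≤ b) :
    |(∫ x in a..b, f x) - (b - a) / 2 * (f a + f b)| ≤ (b - a) ^ 2 / 8 * ∫ x in a..b, |f'' x| := by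
  have hcf : Continuous f := continuous_iff_continuousAt.2 fun x => (hf x).continuousAt
  have hcf' : Continuous f' := continuous_iff_continuousAt.2 fun x => (hf' x).continuousAt
  have h1 := intervalIntegral.integral_mul_deriv_eq_deriv_mul (a := a) (b := b)
    (u := fun x => (x - a) * (x - b) / 2) (u' := fun x => x - (a + b) / 2) (v := f') (v' := f'')
    (fun x _ => by
      have := (((hasDerivAt_id x).sub_const a).mul ((hasDerivAt_id x).sub_const b)).div_const 2
      refine this.congr_deriv ?_
      simp only [id]
      ring)
    (fun x _ => hf' x) ((by fun_prop : Continuous fun x => x - (a + b) / 2).intervalIntegrable _ _)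
    (hc.intervalIntegrable _ _)
  have h2 := intervalIntegral.integral_mul_deriv_eq_deriv_mul (a := a) (b := b)
    (u := fun x => x - (a + b) / 2) (u' := fun _ => 1) (v := f) (v' := f')
    (fun x _ => (hasDerivAt_id x).sub_const _)
    (fun x _ => hf x) (continuous_const.intervalIntegrable _ _) (hcf'.intervalIntegrable _ _)
  simp only [one_mul] at h2
  have h3 : (∫ x in a..b, f x) - (b - a) / 2 * (f a + f b) =
      ∫ x in a..b, (x - a) * (x - b) / 2 * f'' x := by
    rw [h1, h2]
    ring
  rw [h3, ← intervalIntegral.integral_const_mul]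
  refine (intervalIntegral.abs_integral_le_integral_abs hab).trans ?_
  refine intervalIntegral.integral_mono_on hab ?_ ?_ fun x hx => ?_
  · exact Continuous.intervalIntegrable (by fun_prop) _ _
  · exact Continuous.intervalIntegrable (by fun_prop) _ _
  · rw [abs_mul]
    gcongr
    rw [abs_le]
    constructor <;> nlinarith [hx.1, hx.2, sq_nonneg (x - (a + b) / 2),
      mul_nonneg (sub_nonneg.2 hx.1) (sub_nonneg.2 hx.2)]

/-- Error bound for the composite trapezoidal rule for a function with equal boundary values. -/
lemma abs_integral_sub_riemann_le {f f' f'' : ℝ → ℝ} (hf : ∀ x, HasDerivAt f (f' x) x)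
    (hf' : ∀ x, HasDerivAt f' (f'' x) x) (hc : Continuous f'') {L : ℝ} (hL : 0 ≤ L)
    (hper : f L = f 0) {M : ℕ} (hM : M ≠ 0) :
    |(∫ x in (0 : ℝ)..L, f x) - L / M * ∑ j ∈ Finset.range M, f (L * j / M)| ≤
      (L / M) ^ 2 / 8 * ∫ x in (0 : ℝ)..L, |f'' x| := by
  have hM' : (M : ℝ) ≠ 0 := by exact_mod_cast hM
  have hcf : Continuous f := continuous_iff_continuousAt.2 fun x => (hf x).continuousAt
  set a : ℕ → ℝ := fun j => L * j / M with ha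
  have ha0 : a 0 = 0 := by simp [ha]
  have haM : a M = L := by simp [ha, hM']
  have hstep : ∀ j, a (j + 1) - a j = L / M := fun j => by
    simp only [ha]
    push_cast
    field_simp
    ring
  have hmono : ∀ j, a j ≤ a (j + 1) := fun j => by
    have : 0 ≤ L / M := by positivity
    linarith [hstep j]
  have e1 := intervalIntegral.sum_integral_adjacent_intervals (f := f) (a := a) (n := M)
    (μ := MeasureTheory.volume) fun k _ => hcf.intervalIntegrable _ _
  have e2 := intervalIntegral.sum_integral_adjacent_intervals (f := fun x => |f'' x|) (a := a)
    (n := M) (μ := MeasureTheory.volume) fun k _ => hc.abs.intervalIntegrable _ _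
  rw [ha0, haM] at e1 e2
  have e3 : L / M * ∑ j ∈ Finset.range M, f (a j) =
      ∑ j ∈ Finset.range M, (a (j + 1) - a j) / 2 * (f (a j) + f (a (j + 1))) := by
    have h1 := Finset.sum_range_succ (fun j => f (a j)) M
    rw [Finset.sum_range_succ' (fun j => f (a j)) M, ha0, haM, hper] at h1
    simp only [hstep]
    rw [← Finset.mul_sum, Finset.sum_add_distrib]
    have h2 := add_right_cancel h1
    rw [h2]
    ring
  rw [← e1, ← e2, e3, ← Finset.sum_sub_distrib, Finset.mul_sum]
  refine (Finset.abs_sum_le_sum_abs _ _).trans (Finset.sum_le_sum fun j _ => ?_)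
  have := abs_trapezoid_error_le hf hf' hc (hmono j)
  rwa [hstep j] at this ⊢

/-- The Wallis integral `∫₀^π cos^{2p}`. -/
noncomputable def wallisCos (p : ℕ) : ℝ := ∫ x in (0 : ℝ)..Real.pi, Real.cos x ^ (2 * p)

lemma wallisCos_zero : wallisCos 0 = Real.pi := by simp [wallisCos]

lemma wallisCos_succ (p : ℕ) : wallisCos (p + 1) = (2 * p + 1) / (2 * p + 2) * wallisCos p := by
  rw [wallisCos, wallisCos, mul_add, mul_one, integral_cos_pow]
  simp

lemma wallisCos_pos (p : ℕ) : 0 < wallisCos p := by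
  induction p with
  | zero => rw [wallisCos_zero]; exact Real.pi_pos
  | succ p ih => rw [wallisCos_succ]; positivity

lemma wallisCos_le (p : ℕ) : wallisCos p ≤ Real.pi / √(p + 1) := by
  induction p with
  | zero => simp [wallisCos_zero]
  | succ p ih =>
    rw [wallisCos_succ]
    have h1 : (0 : ℝ) < p + 1 := by positivity
    have h2 : (0 : ℝ) < p + 1 + 1 := by positivity
    have key : (2 * p + 1 : ℝ) / (2 * p + 2) * √(p + 1 + 1) ≤ √(p + 1) := by
      apply Real.le_sqrt_of_sq_le
      rw [mul_pow, Real.sq_sqrt h2.le, div_pow, div_mul_eq_mul_div, div_le_iff₀ (by positivity)]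
      nlinarith [(Nat.cast_nonneg p : (0 : ℝ) ≤ p)]
    have hs1 := Real.sqrt_pos.2 h1
    have hs2 := Real.sqrt_pos.2 h2
    push_cast
    rw [le_div_iff₀ hs2] 
    rw [le_div_iff₀ hs1] at ih
    calc (2 * p + 1 : ℝ) / (2 * p + 2) * wallisCos p * √(p + 1 + 1)
        = wallisCos p * ((2 * p + 1 : ℝ) / (2 * p + 2) * √(p + 1 + 1)) := by ring
      _ ≤ wallisCos p * √(p + 1) := by
        gcongr
        exact (wallisCos_pos p).le
      _ ≤ Real.pi := ih

lemma wallisCos_antitone : Antitone wallisCos := by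
  refine antitone_nat_of_succ_le fun p => ?_
  rw [wallisCos_succ]
  have := wallisCos_pos p
  have h : (2 * p + 1 : ℝ) / (2 * p + 2) ≤ 1 := by
    rw [div_le_one (by positivity)]
    linarith
  nlinarith

lemma integral_phi (p : ℕ) :
    ∫ x in (0 : ℝ)..Real.pi, phi p x = wallisCos p - wallisCos (p + 1) := by
  rw [wallisCos, wallisCos, ← intervalIntegral.integral_sub]
  · congr 1
    funext x
    rw [phi, Real.sin_sq]
    ring
  · exact Continuous.intervalIntegrable (by fun_prop) _ _
  · exact Continuous.intervalIntegrable (by fun_prop) _ _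

lemma mean_eq (p : ℕ) : mean p = wallisCos p / (Real.pi * (2 * p + 2)) := by
  rw [mean, integral_phi, wallisCos_succ]
  field_simp
  ring

lemma exists_tendsto_mean : ∃ κ : ℝ, Tendsto (fun p : ℕ => p * √p * mean p / 2) atTop (𝓝 κ) := by
  have hmono : Monotone fun p : ℕ => √p * wallisCos p := by
    refine monotone_nat_of_le_succ fun p => ?_
    rw [wallisCos_succ]
    have key : √(p : ℝ) ≤ √((p + 1 : ℕ) : ℝ) * ((2 * p + 1 : ℝ) / (2 * p + 2)) := by
      have h0 : (0 : ℝ) ≤ (2 * p + 1 : ℝ) / (2 * p + 2) := by positivity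
      rw [← Real.sqrt_sq h0, ← Real.sqrt_mul (by positivity)]
      apply Real.sqrt_le_sqrt
      rw [div_pow, mul_div_assoc', le_div_iff₀ (by positivity)]
      push_cast
      nlinarith [(Nat.cast_nonneg p : (0 : ℝ) ≤ p)]
    have := mul_le_mul_of_nonneg_right key (wallisCos_pos p).le
    linarith
  have hbdd : BddAbove (Set.range fun p : ℕ => √p * wallisCos p) := by
    refine ⟨Real.pi, ?_⟩
    rintro _ ⟨p, rfl⟩
    have h1 := wallisCos_le p
    rw [le_div_iff₀ (by positivity)] at h1
    refine le_trans ?_ h1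
    simp only
    rw [mul_comm]
    have := (wallisCos_pos p).le
    gcongr
    linarith
  have h := tendsto_atTop_ciSup hmono hbdd
  set l := ⨆ p : ℕ, √(p : ℝ) * wallisCos p
  have h2 : Tendsto (fun p : ℕ => (p : ℝ) / (p + 1)) atTop (𝓝 1) := tendsto_natCast_div_add_atTop 1
  refine ⟨l * 1 / (4 * Real.pi), ((h.mul h2).div_const (4 * Real.pi)).congr fun p => ?_⟩
  rw [mean_eq]
  field_simp
  ring

/-- The second derivative of `phi p`. -/
noncomputable def phiDeriv2 (p : ℕ) (x : ℝ) : ℝ :=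
  2 * Real.cos x ^ (2 * (p + 1)) - (10 * p + 2) * (Real.sin x ^ 2 * Real.cos x ^ (2 * p)) +
    2 * p * (2 * p - 1) * (Real.sin x ^ 4 * Real.cos x ^ (2 * (p - 1)))

lemma phi_hasDerivAt (p : ℕ) (x : ℝ) : HasDerivAt (phi p)
    (2 * Real.sin x * Real.cos x ^ (2 * p + 1) -
      2 * p * (Real.sin x ^ 3 * Real.cos x ^ (2 * p - 1))) x := by
  have h := ((Real.hasDerivAt_sin x).pow 2).mul ((Real.hasDerivAt_cos x).pow (2 * p))
  refine h.congr_deriv ?_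
  simp only [Pi.pow_apply]
  push_cast
  ring

lemma phi_hasDerivAt2 (p : ℕ) (x : ℝ) : HasDerivAt
    (fun x => 2 * Real.sin x * Real.cos x ^ (2 * p + 1) -
      2 * p * (Real.sin x ^ 3 * Real.cos x ^ (2 * p - 1))) (phiDeriv2 p x) x := by
  have h := (((Real.hasDerivAt_sin x).const_mul 2).mul
    ((Real.hasDerivAt_cos x).pow (2 * p + 1))).sub
    ((((Real.hasDerivAt_sin x).pow 3).mul ((Real.hasDerivAt_cos x).pow (2 * p - 1))).const_mul
      (2 * p : ℝ))
  refine h.congr_deriv ?_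
  simp only [Pi.pow_apply, phiDeriv2]
  cases p with
  | zero => simp; ring
  | succ r =>
    have e1 : 2 * (r + 1) - 1 = 2 * r + 1 := by omega
    have e2 : 2 * r + 1 - 1 = 2 * r := by omega
    have e3 : r + 1 - 1 = r := by omega
    simp only [e1, e2, e3]
    push_cast
    ring

lemma continuous_phiDeriv2 (p : ℕ) : Continuous (phiDeriv2 p) := by
  unfold phiDeriv2
  fun_prop

lemma integral_abs_phiDeriv2_le (p : ℕ) :
    ∫ x in (0 : ℝ)..Real.pi, |phiDeriv2 p x| ≤ 20 * Real.pi / √(p + 1) := by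
  have hI : ∀ k : ℕ, IntervalIntegrable (fun x => Real.cos x ^ (2 * k)) MeasureTheory.volume
      0 Real.pi := fun k => Continuous.intervalIntegrable (by fun_prop) _ _
  have hbound : ∫ x in (0 : ℝ)..Real.pi, |phiDeriv2 p x| ≤
      ∫ x in (0 : ℝ)..Real.pi, (2 * Real.cos x ^ (2 * (p + 1)) +
        (10 * p + 2) * (Real.cos x ^ (2 * p) - Real.cos x ^ (2 * (p + 1))) +
        4 * p ^ 2 * (Real.cos x ^ (2 * (p - 1)) - 2 * Real.cos x ^ (2 * p) +
          Real.cos x ^ (2 * (p + 1)))) := by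
    refine intervalIntegral.integral_mono_on Real.pi_pos.le ?_ ?_ fun x _ => ?_
    · exact (continuous_phiDeriv2 p).abs.intervalIntegrable _ _
    · exact Continuous.intervalIntegrable (by fun_prop) _ _
    have hev : ∀ k : ℕ, 0 ≤ Real.cos x ^ (2 * k) := fun k => Even.pow_nonneg (even_two_mul k) _
    have e1 : Real.cos x ^ (2 * p) - Real.cos x ^ (2 * (p + 1)) =
        Real.sin x ^ 2 * Real.cos x ^ (2 * p) := by
      rw [Real.sin_sq]
      ring
    have e2 : 4 * p ^ 2 * (Real.cos x ^ (2 * (p - 1)) - 2 * Real.cos x ^ (2 * p) +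
          Real.cos x ^ (2 * (p + 1))) =
        4 * p ^ 2 * (Real.sin x ^ 4 * Real.cos x ^ (2 * (p - 1))) := by
      cases p with
      | zero => simp
      | succ r =>
        have : Real.sin x ^ 4 = (1 - Real.cos x ^ 2) ^ 2 := by
          rw [← Real.sin_sq]
          ring
        rw [this, Nat.add_sub_cancel]
        ring
    rw [e1, e2, phiDeriv2]
    have p1 := hev (p + 1)
    have p2 : 0 ≤ (10 * p + 2) * (Real.sin x ^ 2 * Real.cos x ^ (2 * p)) :=
      mul_nonneg (by positivity) (mul_nonneg (by positivity) (hev p))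
    have p3 : 0 ≤ (Real.sin x ^ 4 * Real.cos x ^ (2 * (p - 1))) :=
      mul_nonneg (by positivity) (hev _)
    have hp : (0 : ℝ) ≤ p := Nat.cast_nonneg p
    have p4 := mul_nonneg hp p3
    have p5 := mul_nonneg (mul_nonneg hp hp) p3
    have hcase : 0 ≤ 2 * (p : ℝ) * (2 * p - 1) := by
      rcases Nat.eq_zero_or_pos p with h | h
      · simp [h]
      · have : (1 : ℝ) ≤ p := by exact_mod_cast h
        have : 0 ≤ 2 * (p : ℝ) - 1 := by linarith
        positivity
    have p6 := mul_nonneg hcase p3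
    rw [abs_le]
    constructor <;> nlinarith
  refine hbound.trans ?_
  have hval : ∫ x in (0 : ℝ)..Real.pi, (2 * Real.cos x ^ (2 * (p + 1)) +
        (10 * p + 2) * (Real.cos x ^ (2 * p) - Real.cos x ^ (2 * (p + 1))) +
        4 * p ^ 2 * (Real.cos x ^ (2 * (p - 1)) - 2 * Real.cos x ^ (2 * p) +
          Real.cos x ^ (2 * (p + 1)))) =
      2 * wallisCos (p + 1) + (10 * p + 2) * (wallisCos p - wallisCos (p + 1)) +
        4 * p ^ 2 * (wallisCos (p - 1) - 2 * wallisCos p + wallisCos (p + 1)) := by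
    rw [intervalIntegral.integral_add, intervalIntegral.integral_add,
      intervalIntegral.integral_const_mul, intervalIntegral.integral_const_mul,
      intervalIntegral.integral_const_mul, intervalIntegral.integral_add,
      intervalIntegral.integral_sub, intervalIntegral.integral_sub,
      intervalIntegral.integral_const_mul]
    · rfl
    all_goals exact Continuous.intervalIntegrable (by fun_prop) _ _
  rw [hval]
  cases p with
  | zero =>
    rw [wallisCos_succ]
    simp only [wallisCos_zero]
    have := Real.pi_pos
    norm_num
    linarith
  | succ r =>
    rw [Nat.add_sub_cancel]
    have hr := wallisCos_pos r
    have hle : 2 * wallisCos (r + 1 + 1) +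
        (10 * (r + 1 : ℕ) + 2) * (wallisCos (r + 1) - wallisCos (r + 1 + 1)) +
        4 * ((r + 1 : ℕ) : ℝ) ^ 2 * (wallisCos r - 2 * wallisCos (r + 1) + wallisCos (r + 1 + 1)) ≤
        10 * wallisCos r := by
      have h1 : wallisCos (r + 1 + 1) ≤ wallisCos r := wallisCos_antitone (by omega)
      have h2 : wallisCos (r + 1) ≤ wallisCos r := wallisCos_antitone (by omega)
      have h3 : (10 * (r + 1 : ℕ) + 2) * (wallisCos (r + 1) - wallisCos (r + 1 + 1)) ≤
          5 * wallisCos (r + 1) := by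
        rw [wallisCos_succ (r + 1)]
        have := wallisCos_pos (r + 1)
        have e : (10 * ((r + 1 : ℕ) : ℝ) + 2) * (wallisCos (r + 1) -
            (2 * ((r + 1 : ℕ) : ℝ) + 1) / (2 * ((r + 1 : ℕ) : ℝ) + 2) * wallisCos (r + 1)) =
            (10 * ((r + 1 : ℕ) : ℝ) + 2) / (2 * ((r + 1 : ℕ) : ℝ) + 2) * wallisCos (r + 1) := by
          field_simp
          ring
        rw [e]
        gcongr
        rw [div_le_iff₀ (by positivity)]
        linarith
      have h4 : 4 * ((r + 1 : ℕ) : ℝ) ^ 2 *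
          (wallisCos r - 2 * wallisCos (r + 1) + wallisCos (r + 1 + 1)) ≤ 3 * wallisCos r := by
        have e : 4 * ((r + 1 : ℕ) : ℝ) ^ 2 *
          (wallisCos r - 2 * wallisCos (r + 1) + wallisCos (r + 1 + 1)) =
            3 * (((r : ℝ) + 1) / (r + 2)) * wallisCos r := by
          rw [wallisCos_succ (r + 1), wallisCos_succ r]
          push_cast
          field_simp
          ring
        rw [e]
        have : ((r : ℝ) + 1) / (r + 2) ≤ 1 := by
          rw [div_le_one (by positivity)]
          linarith
        nlinarith
      linarith
    refine hle.trans ?_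
    have h5 := wallisCos_le r
    have h6 : Real.pi / √((r : ℝ) + 1) ≤ 2 * Real.pi / √((r + 1 : ℕ) + 1) := by
      rw [div_le_div_iff₀ (by positivity) (by positivity), mul_comm (2 * Real.pi), mul_comm 2,
        ← mul_assoc, mul_comm _ Real.pi, mul_assoc]
      gcongr
      rw [Real.sqrt_le_left (by positivity), mul_pow, Real.sq_sqrt (by positivity)]
      push_cast
      linarith [(Nat.cast_nonneg r : (0 : ℝ) ≤ r)]
    have h7 : 20 * Real.pi / √((r + 1 : ℕ) + 1) = 10 * (2 * Real.pi / √((r + 1 : ℕ) + 1)) := by ring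
    rw [h7]
    linarith

/-- The equidistant sums of `phi p` converge quadratically to the mean. -/
lemma abs_mean_sub_riem_le {M : ℕ} (hM : M ≠ 0) (p : ℕ) :
    |mean p - riem M p| ≤ 40 / (M ^ 2 * √(p + 1)) := by
  have h := abs_integral_sub_riemann_le (phi_hasDerivAt p) (phi_hasDerivAt2 p)
    (continuous_phiDeriv2 p) Real.pi_pos.le (by simp [phi]) hM
  have e : mean p - riem M p = ((∫ x in (0 : ℝ)..Real.pi, phi p x) -
      Real.pi / M * ∑ j ∈ Finset.range M, phi p (Real.pi * j / M)) / Real.pi := by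
    rw [mean, riem]
    field_simp
  have hM' : (0 : ℝ) < M := by exact_mod_cast Nat.pos_of_ne_zero hM
  rw [e, abs_div, abs_of_pos Real.pi_pos, div_le_iff₀ Real.pi_pos]
  refine h.trans ((mul_le_mul_of_nonneg_left (integral_abs_phiDeriv2_le p)
    (by positivity)).trans ?_)
  have h2 : (Real.pi / M) ^ 2 / 8 * (20 * Real.pi / √(p + 1)) =
      (5 / 2 * Real.pi ^ 2) / (M ^ 2 * √(p + 1)) * Real.pi := by
    field_simp
    ring
  rw [h2]
  gcongr
  nlinarith [Real.pi_lt_four, Real.pi_pos]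

/-- The difference `(m+1)^α - m^α`, where `0^α = 0` for `α ≠ 0`. -/
noncomputable def powDiff (α : ℝ) (m : ℕ) : ℝ := ((m : ℝ) + 1) ^ α - (m : ℝ) ^ α

lemma abs_powDiff_le {α : ℝ} (hα : α = 1 ∨ α < 0) (m : ℕ) : |powDiff α m| ≤ 1 := by
  rcases hα with rfl | h
  · simp [powDiff]
  · have h1 : ((m : ℝ) + 1) ^ α ≤ 1 :=
      Real.rpow_le_one_of_one_le_of_nonpos (by linarith [(Nat.cast_nonneg m : (0 : ℝ) ≤ m)]) h.le
    have h2 : (0 : ℝ) ≤ ((m : ℝ) + 1) ^ α := by positivity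
    have h3 : (0 : ℝ) ≤ (m : ℝ) ^ α := by positivity
    have h4 : (m : ℝ) ^ α ≤ 1 := by
      rcases Nat.eq_zero_or_pos m with rfl | hm
      · simp [Real.zero_rpow h.ne]
      · exact Real.rpow_le_one_of_one_le_of_nonpos (by exact_mod_cast hm) h.le
    rw [powDiff, abs_le]
    constructor <;> linarith

lemma sum_powDiff_mul {α : ℝ} (hα : α ≠ 0) (u : ℕ → ℝ) (L : ℕ) :
    ∑ m ∈ Finset.range L, ((m : ℝ) + 1) ^ α * (u (m + 1) - u (m + 2)) =
      ∑ m ∈ Finset.range L, powDiff α m * u (m + 1) - (L : ℝ) ^ α * u (L + 1) := by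
  induction L with
  | zero => simp [Real.zero_rpow hα]
  | succ L ih =>
    rw [Finset.sum_range_succ, ih, Finset.sum_range_succ, powDiff]
    push_cast
    ring

/-- Summation by parts for nonincreasing sequences with quadratic decay. -/
lemma tsum_rpow_mul_sub {α C : ℝ} (hα : α = 1 ∨ α < 0) {u : ℕ → ℝ} (hu : Antitone u)
    (hC : ∀ m, |u m| ≤ C / ((m : ℝ) + 1) ^ 2) :
    ∑' m : ℕ, ((m : ℝ) + 1) ^ α * (u (m + 1) - u (m + 2)) = ∑' m, powDiff α m * u (m + 1) := by
  have hα0 : α ≠ 0 := by rcases hα with rfl | h; exacts [one_ne_zero, h.ne]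
  have hα1 : α ≤ 1 := by rcases hα with rfl | h <;> linarith
  have hs2 : Summable fun m : ℕ => 1 / ((m : ℝ) + 1) ^ 2 := by
    have := (summable_nat_add_iff 1).2 (Real.summable_one_div_nat_pow.2 one_lt_two)
    simpa using this
  have hC0 : 0 ≤ C := by
    have := (abs_nonneg _).trans (hC 0)
    simpa using this
  have hsum : Summable fun m => powDiff α m * u (m + 1) := by
    refine Summable.of_norm_bounded (hs2.mul_left C) fun m => ?_
    rw [Real.norm_eq_abs, abs_mul]
    calc |powDiff α m| * |u (m + 1)| ≤ 1 * (C / (((m + 1 : ℕ) : ℝ) + 1) ^ 2) :=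
          mul_le_mul (abs_powDiff_le hα m) (hC _) (abs_nonneg _) zero_le_one
      _ ≤ C * (1 / ((m : ℝ) + 1) ^ 2) := by
        rw [one_mul, mul_one_div]
        gcongr
        linarith
  have hb : Tendsto (fun L : ℕ => (L : ℝ) ^ α * u (L + 1)) atTop (𝓝 0) := by
    refine squeeze_zero_norm (a := fun L : ℕ => C * (1 / ((L : ℝ) + 1))) (fun L => ?_) ?_
    · rw [norm_mul, Real.norm_eq_abs, Real.norm_eq_abs, abs_of_nonneg (by positivity)]
      have h1 : (L : ℝ) ^ α ≤ (L : ℝ) + 1 := by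
        rcases Nat.eq_zero_or_pos L with rfl | hL
        · simp [Real.zero_rpow hα0]
        · have : (L : ℝ) ^ α ≤ (L : ℝ) ^ (1 : ℝ) :=
            Real.rpow_le_rpow_of_exponent_le (by exact_mod_cast hL) hα1
          rw [Real.rpow_one] at this
          linarith
      calc (L : ℝ) ^ α * |u (L + 1)| ≤ ((L : ℝ) + 1) * (C / (((L + 1 : ℕ) : ℝ) + 1) ^ 2) :=
            mul_le_mul h1 (hC _) (abs_nonneg _) (by positivity)
        _ ≤ ((L : ℝ) + 1) * (C / ((L : ℝ) + 1) ^ 2) := by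
          gcongr
          linarith
        _ = C * (1 / ((L : ℝ) + 1)) := by
          field_simp
    · simpa using tendsto_one_div_add_atTop_nhds_zero_nat.const_mul C
  have hlim := hsum.hasSum.tendsto_sum_nat.sub hb
  rw [sub_zero] at hlim
  refine HasSum.tsum_eq ?_
  rw [hasSum_iff_tendsto_nat_of_nonneg]
  · exact hlim.congr fun L => (sum_powDiff_mul hα0 u L).symm
  · intro m
    exact mul_nonneg (by positivity) (sub_nonneg.2 (hu (Nat.le_succ _)))

lemma riem_one (p : ℕ) : riem 1 p = 0 := by simp [riem, phi]

lemma abs_mean_le (p : ℕ) : |mean p| ≤ 40 := by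
  have h := abs_mean_sub_riem_le one_ne_zero p
  rw [riem_one, sub_zero] at h
  refine h.trans ?_
  rw [div_le_iff₀ (by positivity)]
  have : 1 ≤ √((p : ℝ) + 1) := Real.one_le_sqrt.2 (by linarith [(Nat.cast_nonneg p : (0 : ℝ) ≤ p)])
  push_cast
  linarith

lemma abs_mean_sub_riem_le' (m p : ℕ) : |mean p - riem (m + 1) p| ≤ 40 / ((m : ℝ) + 1) ^ 2 := by
  refine (abs_mean_sub_riem_le (Nat.succ_ne_zero m) p).trans ?_
  push_cast
  have : 1 ≤ √((p : ℝ) + 1) := Real.one_le_sqrt.2 (by linarith [(Nat.cast_nonneg p : (0 : ℝ) ≤ p)])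
  gcongr
  have : (0 : ℝ) ≤ ((m : ℝ) + 1) ^ 2 := by positivity
  nlinarith

/-- The coefficients of `W_α` as sums of quadrature errors. -/
lemma coeff_eq_tsum {α : ℝ} (hα : α = 1 ∨ α < 0) {Z : ℕ → ℝ} (hZ : IsCoeffSeq α Z) (p : ℕ) :
    Z (p + 1) = 2 * 4 ^ p * ∑' m, powDiff α m * (mean p - riem (m + 2) p) := by
  set c : ℕ → ℝ := fun p => 2 * 4 ^ p * ∑' m, powDiff α m * (mean p - riem (m + 2) p) with hc
  have hs2 : Summable fun m : ℕ => 1 / ((m : ℝ) + 1) ^ 2 := by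
    have := (summable_nat_add_iff 1).2 (Real.summable_one_div_nat_pow.2 one_lt_two)
    simpa using this
  have key : ∀ g : ℝ, 0 < g → g < 1 / 4 → HasSum (fun p : ℕ => c p * g ^ (p + 1))
      (∑' m : ℕ, ((m : ℝ) + 1) ^ α * (X (m + 2) g - X (m + 1) g)) := by
    intro g hg hg'
    have hgeo : Summable fun p : ℕ => (4 * g) ^ p :=
      summable_geometric_of_lt_one (by positivity) (by linarith)
    have hmean : Summable fun p : ℕ => 2 * 4 ^ p * mean p * g ^ (p + 1) := by
      refine Summable.of_norm_bounded (hgeo.mul_left (80 * g)) fun p => ?_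
      rw [norm_mul, norm_mul, Real.norm_eq_abs, Real.norm_eq_abs, Real.norm_eq_abs,
        abs_of_pos (by positivity : (0 : ℝ) < 2 * 4 ^ p),
        abs_of_pos (by positivity : (0 : ℝ) < g ^ (p + 1))]
      calc 2 * 4 ^ p * |mean p| * g ^ (p + 1) ≤ 2 * 4 ^ p * 40 * g ^ (p + 1) := by
            gcongr
            exact abs_mean_le p
        _ = 80 * g * (4 * g) ^ p := by ring
    set XI := ∑' p : ℕ, 2 * 4 ^ p * mean p * g ^ (p + 1)
    set u : ℕ → ℝ := fun m => XI - X m g with hu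
    have hhas : ∀ m, HasSum (fun p : ℕ => 2 * 4 ^ p * (mean p - riem (m + 1) p) * g ^ (p + 1))
        (u m) := fun m =>
      (hmean.hasSum.sub (hasSum_X hg hg' m)).congr_both (by funext p; ring) rfl
    have hbd : ∀ m p : ℕ, |2 * 4 ^ p * (mean p - riem (m + 1) p) * g ^ (p + 1)| ≤
        80 * g / ((m : ℝ) + 1) ^ 2 * (4 * g) ^ p := by
      intro m p
      rw [abs_mul, abs_mul, abs_of_pos (by positivity : (0 : ℝ) < 2 * 4 ^ p),
        abs_of_pos (by positivity : (0 : ℝ) < g ^ (p + 1))]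
      calc 2 * 4 ^ p * |mean p - riem (m + 1) p| * g ^ (p + 1)
          ≤ 2 * 4 ^ p * (40 / ((m : ℝ) + 1) ^ 2) * g ^ (p + 1) := by
            gcongr
            exact abs_mean_sub_riem_le' m p
        _ = 80 * g / ((m : ℝ) + 1) ^ 2 * (4 * g) ^ p := by
          rw [mul_pow]
          ring
    have hubd : ∀ m, |u m| ≤ (80 * g * ∑' p : ℕ, (4 * g) ^ p) / ((m : ℝ) + 1) ^ 2 := by
      intro m
      have := tsum_of_norm_bounded
        (f := fun p : ℕ => 2 * 4 ^ p * (mean p - riem (m + 1) p) * g ^ (p + 1))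
        (hgeo.hasSum.mul_left (80 * g / ((m : ℝ) + 1) ^ 2)) (hbd m)
      rw [(hhas m).tsum_eq] at this
      refine this.trans (le_of_eq ?_)
      ring
    have hanti : Antitone u := antitone_nat_of_succ_le fun m =>
      sub_le_sub_left (X_le_X_succ hg hg' m) _
    have hW : ∑' m : ℕ, ((m : ℝ) + 1) ^ α * (X (m + 2) g - X (m + 1) g) =
        ∑' m, powDiff α m * u (m + 1) := by
      rw [← tsum_rpow_mul_sub hα hanti hubd]
      congr 1
      funext m
      simp only [hu]
      ring
    have hF : Summable fun x : ℕ × ℕ =>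
        powDiff α x.2 * (2 * 4 ^ x.1 * (mean x.1 - riem (x.2 + 2) x.1) * g ^ (x.1 + 1)) := by
      have hprod := hgeo.mul_of_nonneg (hs2.mul_left (80 * g)) (fun p => by positivity)
        (fun m => by positivity)
      refine Summable.of_norm_bounded hprod fun x => ?_
      rw [Real.norm_eq_abs, abs_mul]
      calc |powDiff α x.2| * |2 * 4 ^ x.1 * (mean x.1 - riem (x.2 + 2) x.1) * g ^ (x.1 + 1)|
          ≤ 1 * (80 * g / (((x.2 + 1 : ℕ) : ℝ) + 1) ^ 2 * (4 * g) ^ x.1) :=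
            mul_le_mul (abs_powDiff_le hα _) (hbd (x.2 + 1) x.1) (abs_nonneg _) zero_le_one
        _ ≤ 1 * (80 * g / ((x.2 : ℝ) + 1) ^ 2 * (4 * g) ^ x.1) := by
          gcongr
          linarith
        _ = (4 * g) ^ x.1 * (80 * g * (1 / ((x.2 : ℝ) + 1) ^ 2)) := by ring
    have h1 := hF.hasSum.prod_fiberwise fun p => (hF.prod_factor p).hasSum
    refine h1.congr_both ?_ ?_
    · funext p
      simp only [hc]
      rw [mul_assoc, ← tsum_mul_right, ← tsum_mul_left]
      congr 1
      funext m
      ring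
    · rw [hW, hF.tsum_prod]
      refine Eq.trans ?_ (Summable.tsum_comm (f := fun p m : ℕ =>
        powDiff α m * (2 * 4 ^ p * (mean p - riem (m + 2) p) * g ^ (p + 1))) hF)
      congr 1
      funext m
      rw [tsum_mul_left]
      congr 1
      exact (hhas (m + 1)).tsum_eq.symm
  set c' : ℕ → ℝ := fun N => Nat.casesOn N 0 c with hc'
  have key2 : ∀ g : ℝ, 0 < g → g < 1 / 4 → HasSum (fun N : ℕ => c' N * g ^ N)
      (∑' m : ℕ, ((m : ℝ) + 1) ^ α * (X (m + 2) g - X (m + 1) g)) := by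
    intro g hg hg'
    rw [← hasSum_nat_add_iff' 1]
    simpa [hc'] using key g hg hg'
  have h0 := coeff_eq_zero_of_hasSum_zero (d := fun N => Z N - c' N) (r := 1 / 4) (by norm_num)
    (fun g hg hg' => ((hZ g hg hg').sub (key2 g hg hg')).congr_both (by funext N; ring)
      (sub_self _).symm) (p + 1)
  exact sub_eq_zero.1 h0

lemma powDiff_nonpos {α : ℝ} (hα : α < 0) {m : ℕ} (hm : m ≠ 0) : powDiff α m ≤ 0 := by
  have : (0 : ℝ) < m := by exact_mod_cast Nat.pos_of_ne_zero hm
  exact sub_nonpos.2 (Real.rpow_le_rpow_of_nonpos this (by linarith) hα.le)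

lemma hasSum_powDiff {α : ℝ} (hα : α < 0) : HasSum (powDiff α) 0 := by
  have hpart : ∀ L : ℕ, ∑ m ∈ Finset.range L, powDiff α m = (L : ℝ) ^ α := by
    intro L
    induction L with
    | zero => simp [Real.zero_rpow hα.ne]
    | succ L ih =>
      rw [Finset.sum_range_succ, ih, powDiff]
      push_cast
      ring
  have hlim : Tendsto (fun L : ℕ => (L : ℝ) ^ α) atTop (𝓝 0) := by
    have := (tendsto_rpow_neg_atTop (neg_pos.2 hα)).comp tendsto_natCast_atTop_atTop
    simpa [Function.comp_def] using this
  have h : HasSum (fun m => -powDiff α (m + 1)) (powDiff α 0) := by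
    rw [hasSum_iff_tendsto_nat_of_nonneg
      fun m => neg_nonneg.2 (powDiff_nonpos hα (Nat.succ_ne_zero m))]
    have h2 : Tendsto (fun L : ℕ => powDiff α 0 - ((L + 1 : ℕ) : ℝ) ^ α) atTop
        (𝓝 (powDiff α 0 - 0)) :=
      tendsto_const_nhds.sub ((tendsto_add_atTop_iff_nat 1).2 hlim)
    rw [sub_zero] at h2
    refine h2.congr fun L => ?_
    rw [← hpart, Finset.sum_range_succ', Finset.sum_neg_distrib]
    ring
  rw [← hasSum_nat_add_iff' 1]
  simpa using h.neg

/-- For `α < 0` the mean drops out of the coefficient formula. -/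
lemma coeff_eq_tsum_of_neg {α : ℝ} (hα : α < 0) {Z : ℕ → ℝ} (hZ : IsCoeffSeq α Z) (p : ℕ) :
    Z (p + 1) = 2 * 4 ^ p * ∑' m, -powDiff α m * riem (m + 2) p := by
  rw [coeff_eq_tsum (Or.inr hα) hZ]
  have h1 := hasSum_powDiff hα
  have hs2 : Summable fun m : ℕ => 1 / ((m : ℝ) + 1) ^ 2 := by
    have := (summable_nat_add_iff 1).2 (Real.summable_one_div_nat_pow.2 one_lt_two)
    simpa using this
  have h2 : Summable fun m => powDiff α m * (mean p - riem (m + 2) p) := by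
    refine Summable.of_norm_bounded (hs2.mul_left 40) fun m => ?_
    rw [Real.norm_eq_abs, abs_mul]
    calc |powDiff α m| * |mean p - riem (m + 2) p| ≤ 1 * (40 / (((m + 1 : ℕ) : ℝ) + 1) ^ 2) :=
          mul_le_mul (abs_powDiff_le (Or.inr hα) _) (abs_mean_sub_riem_le' (m + 1) p)
            (abs_nonneg _) zero_le_one
      _ ≤ 40 * (1 / ((m : ℝ) + 1) ^ 2) := by
        rw [one_mul, mul_one_div]
        gcongr
        linarith
  congr 1
  have h3 := h2.hasSum.sub (h1.mul_right (mean p))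
  rw [zero_mul, sub_zero] at h3
  rw [← h3.tsum_eq]
  congr 1
  funext m
  ring

lemma phi_reflect (p : ℕ) (x : ℝ) : phi p (Real.pi - x) = phi p x := by
  simp only [phi, Real.sin_pi_sub, Real.cos_pi_sub]
  rw [Even.neg_pow (even_two_mul p)]

/-- By reflection, the Riemann sum is twice the sum over the first half of the interval. -/
lemma riem_eq_half {p : ℕ} (hp : p ≠ 0) (M : ℕ) :
    riem M p = 2 / M * ∑ j ∈ Finset.range M,
      if 2 * j < M then phi p (Real.pi * j / M) else 0 := by
  rcases Nat.eq_zero_or_pos M with rfl | hM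
  · simp [riem]
  have hM' : (M : ℝ) ≠ 0 := by exact_mod_cast hM.ne'
  have hmid : ∀ j : ℕ, phi p (Real.pi * j / M) =
      (if 2 * j < M then phi p (Real.pi * j / M) else 0) +
        (if M < 2 * j then phi p (Real.pi * j / M) else 0) := by
    intro j
    rcases lt_trichotomy (2 * j) M with h | h | h
    · simp [h, h.le.not_gt]
    · have : Real.pi * j / M = Real.pi / 2 := by
        rw [← h]
        push_cast
        have : (j : ℝ) ≠ 0 := by
          intro h0
          apply hM'
          rw [← h]
          push_cast
          rw [h0, mul_zero]
        field_simp
      rw [this]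
      simp [phi, hp, h]
    · simp [h, h.le.not_gt]
  have h2 : ∑ j ∈ Finset.range M, (if M < 2 * j then phi p (Real.pi * j / M) else 0) =
      ∑ j ∈ Finset.range M, if 2 * j < M then phi p (Real.pi * j / M) else 0 := by
    have e0 : ∀ f : ℕ → ℝ, f 0 = 0 → ∑ j ∈ Finset.range M, f j =
        ∑ j ∈ Finset.range (M - 1), f (j + 1) := by
      intro f hf
      obtain ⟨L, rfl⟩ := Nat.exists_eq_succ_of_ne_zero hM.ne'
      rw [Finset.sum_range_succ', hf, add_zero]
      rfl
    rw [e0 _ (by simp), e0 _ (by simp [phi]), ← Finset.sum_range_reflect]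
    refine Finset.sum_congr rfl fun j hj => ?_
    rw [Finset.mem_range] at hj
    have e : M - 1 - 1 - j + 1 = M - (j + 1) := by omega
    have e' : ((M - (j + 1) : ℕ) : ℝ) = M - ((j + 1 : ℕ) : ℝ) := Nat.cast_sub (by omega)
    rw [e, e', mul_sub, sub_div, mul_div_cancel_right₀ _ hM', phi_reflect]
    refine if_congr ?_ rfl rfl
    omega
  rw [riem, Finset.sum_congr rfl fun j _ => hmid j, Finset.sum_add_distrib, h2]
  ring

/-- The rescaled mean value `p^{3/2} mean p / 2`. -/
noncomputable def scaledMean (p : ℕ) : ℝ := p * √p * mean p / 2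

/-- The rescaled Riemann sum `p^{3/2} riem M p / 2`. -/
noncomputable def scaledRiem (M p : ℕ) : ℝ := p * √p * riem M p / 2

/-- The `j`-th contribution to the rescaled Riemann sum. -/
noncomputable def riemTerm (M p j : ℕ) : ℝ :=
  p * √p / M * if 2 * j < M then phi p (Real.pi * j / M) else 0

lemma riemTerm_nonneg (M p j : ℕ) : 0 ≤ riemTerm M p j := by
  unfold riemTerm
  split_ifs
  · have := phi_nonneg p (Real.pi * j / M)
    positivity
  · simp

lemma scaledRiem_nonneg (M p : ℕ) : 0 ≤ scaledRiem M p := by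
  have := riem_nonneg M p
  unfold scaledRiem
  positivity

lemma scaledRiem_eq_tsum (M p : ℕ) : scaledRiem M p = ∑' j, riemTerm M p j := by
  rcases eq_or_ne p 0 with rfl | hp
  · simp [scaledRiem, riemTerm]
  rw [tsum_eq_sum (s := Finset.range M), scaledRiem, riem_eq_half hp]
  · simp only [riemTerm]
    rw [← Finset.mul_sum]
    ring
  · intro j hj
    rw [Finset.mem_range, not_lt] at hj
    rw [riemTerm, if_neg (by omega), mul_zero]

lemma pow_mul_exp_neg_le (k : ℕ) {y : ℝ} (hy : 0 ≤ y) : y ^ k * Real.exp (-y) ≤ k.factorial := by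
  have h := Real.pow_div_factorial_le_exp y hy k
  rw [div_le_iff₀ (by positivity)] at h
  rw [Real.exp_neg, ← div_eq_mul_inv, div_le_iff₀ (Real.exp_pos y), mul_comm]
  exact h

lemma phi_le {x : ℝ} (hx : 0 ≤ x) (hx' : x ≤ Real.pi / 2) (p : ℕ) :
    phi p x ≤ x ^ 2 * Real.exp (-(4 * p * x ^ 2 / Real.pi ^ 2)) := by
  have hpi := Real.pi_pos
  have hc : 0 ≤ Real.cos x := Real.cos_nonneg_of_mem_Icc ⟨by linarith, hx'⟩
  have h1 : Real.cos x ≤ Real.exp (-(2 / Real.pi ^ 2 * x ^ 2)) := by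
    have := Real.cos_le_one_sub_mul_cos_sq (x := x) (by rw [abs_of_nonneg hx]; linarith)
    have := Real.add_one_le_exp (-(2 / Real.pi ^ 2 * x ^ 2))
    linarith
  have h2 : Real.cos x ^ (2 * p) ≤ Real.exp (-(4 * p * x ^ 2 / Real.pi ^ 2)) := by
    refine (pow_le_pow_left₀ hc h1 _).trans (le_of_eq ?_)
    rw [← Real.exp_nat_mul]
    congr 1
    push_cast
    ring
  have h3 : Real.sin x ^ 2 ≤ x ^ 2 :=
    pow_le_pow_left₀ (Real.sin_nonneg_of_nonneg_of_le_pi hx (by linarith)) (Real.sin_le hx) 2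
  exact mul_le_mul h3 h2 (by positivity) (by positivity)

/-- The number of sample points attached to the scaling variable `t`. -/
noncomputable def samples (p : ℕ) (t : ℝ) : ℕ := ⌈√p * t⌉₊

lemma le_samples (p : ℕ) (t : ℝ) : √p * t ≤ samples p t := Nat.le_ceil _

lemma riemTerm_samples_le (k p j : ℕ) {t : ℝ} (ht : 0 < t) :
    riemTerm (samples p t) p j ≤
      3 * (k + 1).factorial * t ^ (2 * k) / t * (1 / (j : ℝ) ^ (2 * k)) := by
  have hpi := Real.pi_pos
  set M := samples p t with hM
  rcases eq_or_ne p 0 with rfl | hp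
  · simp only [riemTerm, Nat.cast_zero, zero_mul, zero_div]
    positivity
  rcases eq_or_ne j 0 with rfl | hj
  · simp only [riemTerm, phi, Nat.cast_zero, mul_zero, zero_div, Real.sin_zero]
    simp only [ne_eq, OfNat.ofNat_ne_zero, not_false_eq_true, zero_pow, zero_mul, ite_self,
      mul_zero]
    positivity
  unfold riemTerm
  split_ifs with hjM
  swap
  · rw [mul_zero]
    positivity
  have hp' : (0 : ℝ) < p := by exact_mod_cast Nat.pos_of_ne_zero hp
  have hj' : (0 : ℝ) < j := by exact_mod_cast Nat.pos_of_ne_zero hj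
  have hM3 : 3 ≤ M := by omega
  have hM3' : (3 : ℝ) ≤ M := by exact_mod_cast hM3
  have hMpos : (0 : ℝ) < M := by linarith
  have hlow : √p * t ≤ M := le_samples p t
  have hup : (M : ℝ) < √p * t + 1 := Nat.ceil_lt_add_one (by positivity)
  have hup' : (M : ℝ) ≤ 2 * (√p * t) := by linarith
  have hx : Real.pi * j / M ≤ Real.pi / 2 := by
    have : (2 : ℝ) * j < M := by exact_mod_cast hjM
    rw [div_le_div_iff₀ hMpos two_pos]
    nlinarith
  have h1 := phi_le (x := Real.pi * j / M) (by positivity) hx p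
  set y : ℝ := 4 * p * j ^ 2 / M ^ 2 with hy
  have hypos : 0 < y := by positivity
  have e1 : 4 * p * (Real.pi * j / M) ^ 2 / Real.pi ^ 2 = y := by
    rw [hy]
    field_simp
  rw [e1] at h1
  have hyt : (j : ℝ) ^ 2 / t ^ 2 ≤ y := by
    rw [hy, div_le_div_iff₀ (by positivity) (by positivity)]
    have : (M : ℝ) ^ 2 ≤ (2 * (√p * t)) ^ 2 := pow_le_pow_left₀ hMpos.le hup' 2
    rw [mul_pow, mul_pow, Real.sq_sqrt hp'.le] at this
    nlinarith [sq_nonneg (j : ℝ)]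
  have h2 : y * Real.exp (-y) ≤ (k + 1).factorial * (t ^ (2 * k) * (1 / (j : ℝ) ^ (2 * k))) := by
    have := pow_mul_exp_neg_le (k + 1) hypos.le
    have h3 : y * Real.exp (-y) * y ^ k ≤ (k + 1).factorial := by
      calc y * Real.exp (-y) * y ^ k = y ^ (k + 1) * Real.exp (-y) := by ring
        _ ≤ _ := this
    have h4 : y * Real.exp (-y) * ((j : ℝ) ^ 2 / t ^ 2) ^ k ≤ (k + 1).factorial :=
      (by gcongr : _ ≤ y * Real.exp (-y) * y ^ k).trans h3
    calc y * Real.exp (-y) = y * Real.exp (-y) * ((j : ℝ) ^ 2 / t ^ 2) ^ k *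
          (t ^ (2 * k) * (1 / (j : ℝ) ^ (2 * k))) := by
          rw [div_pow, ← pow_mul, ← pow_mul]
          field_simp
      _ ≤ _ := by gcongr
  have h5 : √p / M ≤ 1 / t := by
    rw [div_le_div_iff₀ hMpos ht]
    linarith
  calc p * √p / M * phi p (Real.pi * j / M)
      ≤ p * √p / M * ((Real.pi * j / M) ^ 2 * Real.exp (-y)) := by gcongr
    _ = √p / M * (Real.pi ^ 2 / 4 * (y * Real.exp (-y))) := by
      rw [hy]
      field_simp
    _ ≤ 1 / t * (3 * ((k + 1).factorial * (t ^ (2 * k) * (1 / (j : ℝ) ^ (2 * k))))) := by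
      have : Real.pi ^ 2 / 4 ≤ 3 := by nlinarith [Real.pi_lt_d2]
      gcongr
    _ = _ := by ring

lemma summable_inv_even_pow {k : ℕ} (hk : k ≠ 0) : Summable fun j : ℕ => 1 / (j : ℝ) ^ (2 * k) :=
  Real.summable_one_div_nat_pow.2 (by omega)

/-- The sum `∑_{j ≥ 1} j^{-2k}`. -/
noncomputable def zetaEven (k : ℕ) : ℝ := ∑' j : ℕ, 1 / (j : ℝ) ^ (2 * k)

lemma zetaEven_nonneg (k : ℕ) : 0 ≤ zetaEven k := tsum_nonneg fun _ => by positivity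

lemma scaledRiem_samples_le {k : ℕ} (hk : k ≠ 0) (p : ℕ) {t : ℝ} (ht : 0 < t) :
    scaledRiem (samples p t) p ≤ 3 * (k + 1).factorial * zetaEven k * (t ^ (2 * k) / t) := by
  rw [scaledRiem_eq_tsum]
  have hs := (summable_inv_even_pow hk).mul_left (3 * (k + 1).factorial * t ^ (2 * k) / t)
  calc ∑' j, riemTerm (samples p t) p j
      ≤ ∑' j : ℕ, 3 * (k + 1).factorial * t ^ (2 * k) / t * (1 / (j : ℝ) ^ (2 * k)) :=
        (Summable.of_nonneg_of_le (fun j => riemTerm_nonneg _ p j)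
          (fun j => riemTerm_samples_le k p j ht) hs).tsum_le_tsum
          (fun j => riemTerm_samples_le k p j ht) hs
    _ = _ := by
      rw [tsum_mul_left, zetaEven]
      ring

lemma scaledMean_nonneg (p : ℕ) : 0 ≤ scaledMean p := by
  have := (wallisCos_pos p).le
  have := Real.pi_pos
  rw [scaledMean, mean_eq]
  positivity

lemma scaledMean_le (p : ℕ) : scaledMean p ≤ 1 := by
  have hpi := Real.pi_pos
  rw [scaledMean, mean_eq]
  have h1 : √(p : ℝ) ≤ √(p + 1) := Real.sqrt_le_sqrt (by linarith)
  have h2 : √(p : ℝ) * wallisCos p ≤ Real.pi := by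
    calc √(p : ℝ) * wallisCos p ≤ √(p + 1) * (Real.pi / √(p + 1)) :=
          mul_le_mul h1 (wallisCos_le p) (wallisCos_pos p).le (by positivity)
      _ = Real.pi := by
        have : √((p : ℝ) + 1) ≠ 0 := by positivity
        field_simp
  have : (p : ℝ) * √p * (wallisCos p / (Real.pi * (2 * p + 2))) / 2 =
      p / (2 * p + 2) * (√p * wallisCos p / Real.pi) / 2 := by field_simp
  rw [this]
  have h3 : (p : ℝ) / (2 * p + 2) ≤ 1 := by
    rw [div_le_one (by positivity)]
    linarith [(Nat.cast_nonneg p : (0 : ℝ) ≤ p)]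
  have h4 : √p * wallisCos p / Real.pi ≤ 1 := (div_le_one hpi).2 h2
  have h5 : 0 ≤ √p * wallisCos p / Real.pi :=
    div_nonneg (mul_nonneg (Real.sqrt_nonneg _) (wallisCos_pos p).le) hpi.le
  nlinarith [mul_le_one₀ h3 h5 h4]

lemma abs_scaledMean_sub_le (p : ℕ) {t : ℝ} (ht : 0 < t) :
    |scaledMean p - scaledRiem (samples p t) p| ≤ 20 / t ^ 2 := by
  rcases eq_or_ne p 0 with rfl | hp
  · simp [scaledMean, scaledRiem]
    positivity
  have hp' : (0 : ℝ) < p := by exact_mod_cast Nat.pos_of_ne_zero hp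
  have hM : √p * t ≤ samples p t := le_samples p t
  have hpos : 0 < √p * t := by positivity
  have hM0 : samples p t ≠ 0 := by
    intro h
    rw [h, Nat.cast_zero] at hM
    linarith
  have h := abs_mean_sub_riem_le hM0 p
  have e : scaledMean p - scaledRiem (samples p t) p =
      p * √p / 2 * (mean p - riem (samples p t) p) := by
    rw [scaledMean, scaledRiem]
    ring
  rw [e, abs_mul, abs_of_pos (by positivity : (0 : ℝ) < p * √p / 2)]
  calc p * √p / 2 * |mean p - riem (samples p t) p|
      ≤ p * √p / 2 * (40 / ((samples p t : ℝ) ^ 2 * √(p + 1))) := by gcongr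
    _ ≤ p * √p / 2 * (40 / ((√p * t) ^ 2 * √p)) := by
      gcongr
      linarith
    _ = 20 / t ^ 2 := by
      rw [mul_pow, Real.sq_sqrt hp'.le]
      have : √(p : ℝ) ≠ 0 := by positivity
      field_simp
      norm_num

lemma tendsto_samples_div_sqrt {t : ℝ} (ht : 0 < t) :
    Tendsto (fun p : ℕ => (samples p t : ℝ) / √p) atTop (𝓝 t) := by
  have h := (tendsto_nat_ceil_mul_div_atTop ht.le).comp
    (Real.tendsto_sqrt_atTop.comp tendsto_natCast_atTop_atTop)
  refine h.congr fun p => ?_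
  simp only [Function.comp_apply, samples, mul_comm]

lemma tendsto_samples {t : ℝ} (ht : 0 < t) : Tendsto (fun p : ℕ => samples p t) atTop atTop := by
  have h : Tendsto (fun p : ℕ => √(p : ℝ) * t) atTop atTop :=
    (Real.tendsto_sqrt_atTop.comp tendsto_natCast_atTop_atTop).atTop_mul_const ht
  exact tendsto_nat_ceil_atTop.comp h

/-- The `j`-th term of the limiting kernel. -/
noncomputable def kernelTerm (t : ℝ) (j : ℕ) : ℝ :=
  1 / t * ((Real.pi * j / t) ^ 2 * Real.exp (-(Real.pi * j / t) ^ 2))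

/-- The scaling limit of the Riemann sums. -/
noncomputable def kernel (t : ℝ) : ℝ := ∑' j, kernelTerm t j

lemma tendsto_riemTerm (j : ℕ) {t : ℝ} (ht : 0 < t) :
    Tendsto (fun p : ℕ => riemTerm (samples p t) p j) atTop (𝓝 (kernelTerm t j)) := by
  have hM := tendsto_samples ht
  have hMt := tendsto_samples_div_sqrt ht
  have hMR : Tendsto (fun p : ℕ => (samples p t : ℝ)) atTop atTop :=
    tendsto_natCast_atTop_atTop.comp hM
  have h1 : Tendsto (fun p : ℕ => √p / (samples p t : ℝ)) atTop (𝓝 (1 / t)) := by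
    have := hMt.inv₀ ht.ne'
    rw [one_div]
    exact this.congr fun p => by rw [inv_div]
  have hx0 : Tendsto (fun p : ℕ => Real.pi * j / (samples p t : ℝ)) atTop (𝓝 0) :=
    hMR.const_div_atTop _
  have hx1 : Tendsto (fun p : ℕ => √p * (Real.pi * j / (samples p t : ℝ))) atTop
      (𝓝 (Real.pi * j / t)) := by
    have := h1.const_mul (Real.pi * j)
    rw [mul_one_div] at this
    exact this.congr fun p => by ring
  have hsinc : Tendsto (fun p : ℕ => Real.sinc (Real.pi * j / (samples p t : ℝ))) atTop (𝓝 1) := by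
    have := (Real.continuous_sinc.tendsto 0).comp hx0
    rwa [Real.sinc_zero] at this
  have hs : Tendsto (fun p : ℕ => √p * Real.sin (Real.pi * j / (samples p t : ℝ))) atTop
      (𝓝 (Real.pi * j / t)) := by
    have := hx1.mul hsinc
    rw [mul_one] at this
    refine this.congr fun p => ?_
    rcases eq_or_ne (Real.pi * j / (samples p t : ℝ)) 0 with h0 | h0
    · simp [h0]
    · rw [Real.sinc_of_ne_zero h0]
      generalize Real.pi * j / (samples p t : ℝ) = x at h0 ⊢
      field_simp
  have hs2 : Tendsto (fun p : ℕ => (p : ℝ) * -Real.sin (Real.pi * j / (samples p t : ℝ)) ^ 2) atTop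
      (𝓝 (-(Real.pi * j / t) ^ 2)) := by
    refine (hs.pow 2).neg.congr fun p => ?_
    rw [mul_pow, Real.sq_sqrt (Nat.cast_nonneg p)]
    ring
  have hexp := Real.tendsto_one_add_pow_exp_of_tendsto hs2
  refine (h1.mul ((hs.pow 2).mul hexp)).congr' ?_
  filter_upwards [hM.eventually_gt_atTop (2 * j)] with p hp
  rw [riemTerm, if_pos hp, phi, mul_pow, Real.sq_sqrt (Nat.cast_nonneg p), pow_mul, Real.cos_sq',
    sub_eq_add_neg]
  ring

lemma tendsto_scaledRiem {t : ℝ} (ht : 0 < t) :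
    Tendsto (fun p : ℕ => scaledRiem (samples p t) p) atTop (𝓝 (kernel t)) := by
  have hb := (summable_inv_even_pow one_ne_zero).mul_left (3 * (1 + 1).factorial * t ^ (2 * 1) / t)
  have : Tendsto (fun p : ℕ => ∑' j, riemTerm (samples p t) p j) atTop (𝓝 (kernel t)) := by
    refine tendsto_tsum_of_dominated_convergence hb (fun j => tendsto_riemTerm j ht)
      (Eventually.of_forall fun p j => ?_)
    rw [Real.norm_eq_abs, abs_of_nonneg (riemTerm_nonneg _ _ _)]
    exact riemTerm_samples_le 1 p j ht
  exact this.congr fun p => (scaledRiem_eq_tsum _ p).symm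

lemma kernelTerm_nonneg {t : ℝ} (ht : 0 < t) (j : ℕ) : 0 ≤ kernelTerm t j := by
  unfold kernelTerm
  positivity

open MeasureTheory in
/-- Passage from a sum to an integral over the scaling variable. -/
lemma integral_samples {p : ℕ} (hp : p ≠ 0) (g : ℕ → ℝ)
    (hg : IntegrableOn (fun t => g (samples p t)) (Set.Ioi 0)) :
    HasSum (fun m : ℕ => g (m + 1)) (√p * ∫ t in Set.Ioi (0 : ℝ), g (samples p t)) := by
  have hp' : (0 : ℝ) < p := by exact_mod_cast Nat.pos_of_ne_zero hp
  have hs : 0 < √(p : ℝ) := Real.sqrt_pos.2 hp'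
  set s : ℕ → Set ℝ := fun m => Set.Ioc (m / √(p : ℝ)) ((m + 1 : ℝ) / √p) with hsdef
  have hmem : ∀ m t, t ∈ s m → samples p t = m + 1 := by
    rintro m t ⟨h1, h2⟩
    rw [div_lt_iff₀ hs] at h1
    rw [le_div_iff₀ hs] at h2
    rw [samples, Nat.ceil_eq_iff (Nat.succ_ne_zero m)]
    push_cast
    constructor
    · linarith
    · linarith
  have hU : ⋃ m, s m = Set.Ioi 0 := by
    ext t
    simp only [Set.mem_iUnion, Set.mem_Ioi]
    constructor
    · rintro ⟨m, h1, -⟩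
      exact lt_of_le_of_lt (by positivity) h1
    · intro ht
      have hpos : 0 < samples p t := Nat.ceil_pos.2 (by positivity)
      refine ⟨samples p t - 1, ?_, ?_⟩
      · rw [div_lt_iff₀ hs]
        have := Nat.ceil_lt_add_one (a := √(p : ℝ) * t) (by positivity)
        rw [Nat.cast_sub hpos]
        push_cast
        unfold samples
        linarith
      · rw [le_div_iff₀ hs, Nat.cast_sub hpos]
        have := le_samples p t
        push_cast
        linarith
  have hdisj : Pairwise (Function.onFun Disjoint s) := by
    intro m m' hmm
    rw [Function.onFun, Set.disjoint_left]
    intro t h1 h2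
    have := (hmem m t h1).symm.trans (hmem m' t h2)
    omega
  rw [← hU] at hg ⊢
  have h := hasSum_integral_iUnion (fun m => measurableSet_Ioc) hdisj hg
  refine (h.mul_left (√(p : ℝ))).congr_both ?_ rfl
  funext m
  rw [setIntegral_congr_fun (g := fun _ => g (m + 1)) measurableSet_Ioc
    (fun t ht => by simp only [hmem m t ht]), setIntegral_const, measureReal_def, Real.volume_Ioc,
    ENNReal.toReal_ofReal]
  · rw [smul_eq_mul]
    field_simp
    ring
  · rw [← sub_div]
    have : (m + 1 : ℝ) - m = 1 := by ring
    rw [this]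
    positivity

lemma measurable_samples (p : ℕ) : Measurable (samples p) :=
  Nat.measurable_ceil.comp (measurable_const.mul measurable_id)

lemma le_of_bounds {a b t y : ℝ} (ha : 0 ≤ a) (hb : 0 ≤ b) (ht : 0 < t) (h1 : t ≤ 1 → y ≤ a)
    (h2 : 1 ≤ t → y ≤ b / t ^ 2) : y ≤ 2 * (a + b) * (1 + t ^ 2)⁻¹ := by
  rw [← div_eq_mul_inv, le_div_iff₀ (by positivity)]
  rcases le_total t 1 with h | h
  · have := h1 h
    have h3 : t ^ 2 ≤ 1 := pow_le_one₀ ht.le h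
    nlinarith [sq_nonneg t]
  · have := h2 h
    rw [le_div_iff₀ (by positivity)] at this
    have h3 : 1 ≤ t ^ 2 := one_le_pow₀ h
    rcases le_total y 0 with hy | hy
    · nlinarith
    · nlinarith

lemma aestronglyMeasurable_samples (g : ℕ → ℝ) (p : ℕ) (s : Set ℝ) :
    MeasureTheory.AEStronglyMeasurable (fun t => g (samples p t))
      (MeasureTheory.volume.restrict s) :=
  ((measurable_of_countable g).comp (measurable_samples p)).aestronglyMeasurable

lemma abs_scaledMean_sub_samples_le (p : ℕ) {t : ℝ} (ht : 0 < t) :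
    |scaledMean p - scaledRiem (samples p t) p| ≤
      2 * (1 + 6 * zetaEven 1 + 20) * (1 + t ^ 2)⁻¹ := by
  have hz := zetaEven_nonneg 1
  refine le_of_bounds (by positivity) (by norm_num) ht (fun h => ?_)
    (fun _ => abs_scaledMean_sub_le p ht)
  have h1 := scaledRiem_samples_le one_ne_zero p ht
  have h2 := scaledRiem_nonneg (samples p t) p
  have h3 := scaledMean_le p
  have h4 := scaledMean_nonneg p
  have h5 : t ^ (2 * 1) / t = t := by field_simp
  rw [h5] at h1
  norm_num [Nat.factorial] at h1
  have h6 : 6 * zetaEven 1 * t ≤ 6 * zetaEven 1 := mul_le_of_le_one_right (by positivity) h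
  rw [abs_le]
  constructor <;> linarith

open MeasureTheory in
lemma tendsto_coeff_one {Z : ℕ → ℝ} (hZ : IsCoeffSeq 1 Z) {κ : ℝ}
    (hκ : Tendsto scaledMean atTop (𝓝 κ)) :
    Tendsto (fun p : ℕ => p * Z (p + 1) / 4 ^ (p + 1)) atTop
      (𝓝 (∫ t in Set.Ioi (0 : ℝ), (κ - kernel t))) := by
  have hbi : IntegrableOn (fun t : ℝ => 2 * (1 + 6 * zetaEven 1 + 20) * (1 + t ^ 2)⁻¹)
      (Set.Ioi 0) := (integrable_inv_one_add_sq.const_mul _).integrableOn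
  have hbound : ∀ p : ℕ, ∀ᵐ t ∂(volume.restrict (Set.Ioi (0 : ℝ))),
      ‖scaledMean p - scaledRiem (samples p t) p‖ ≤
        2 * (1 + 6 * zetaEven 1 + 20) * (1 + t ^ 2)⁻¹ := fun p =>
    (ae_restrict_iff' measurableSet_Ioi).2 (Eventually.of_forall fun t ht =>
      abs_scaledMean_sub_samples_le p ht)
  have hmeas : ∀ p : ℕ, AEStronglyMeasurable (fun t => scaledMean p - scaledRiem (samples p t) p)
      (volume.restrict (Set.Ioi (0 : ℝ))) := fun p =>
    aestronglyMeasurable_samples (fun M => scaledMean p - scaledRiem M p) p _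
  have hlim := tendsto_integral_of_dominated_convergence _ hmeas hbi hbound
    ((ae_restrict_iff' measurableSet_Ioi).2 (Eventually.of_forall fun t ht =>
      hκ.sub (tendsto_scaledRiem ht)))
  have hzero : Tendsto (fun p : ℕ => scaledMean p / √p) atTop (𝓝 0) :=
    hκ.div_atTop (Real.tendsto_sqrt_atTop.comp tendsto_natCast_atTop_atTop)
  have h := hlim.sub hzero
  rw [sub_zero] at h
  refine h.congr' ?_
  filter_upwards [eventually_ne_atTop 0] with p hp
  have hp' : (0 : ℝ) < p := by exact_mod_cast Nat.pos_of_ne_zero hp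
  have hs : 0 < √(p : ℝ) := Real.sqrt_pos.2 hp'
  have hint : IntegrableOn (fun t => scaledMean p - scaledRiem (samples p t) p) (Set.Ioi 0) :=
    Integrable.mono' hbi (hmeas p) (hbound p)
  have h1 := integral_samples hp (fun M => scaledMean p - scaledRiem M p) hint
  rw [← hasSum_nat_add_iff' 1] at h1
  simp only [Finset.sum_range_one, zero_add, scaledRiem, riem_one, scaledMean] at h1
  have h2 := (h1.mul_left (2 / (p * √p))).tsum_eq
  rw [coeff_eq_tsum (Or.inl rfl) hZ p]
  have h3 : ∑' m : ℕ, powDiff 1 m * (mean p - riem (m + 2) p) =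
      ∑' m : ℕ, 2 / (p * √p) * (p * √p * mean p / 2 - p * √p * riem (m + 1 + 1) p / 2) := by
    congr 1
    funext m
    simp only [powDiff, Real.rpow_one]
    field_simp
    ring
  rw [h3, h2]
  simp only [scaledMean, scaledRiem]
  field_simp
  have := Real.sq_sqrt hp'.le
  ring

lemma neg_powDiff_eq (n : ℕ) {m : ℕ} (hm : m ≠ 0) :
    -powDiff (-(2 * (n : ℝ) - 1)) m =
      m * (1 - (1 + 1 / (m : ℝ)) ^ (-(2 * (n : ℝ) - 1))) * (1 / (m : ℝ)) ^ (2 * n) := by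
  have hm' : (0 : ℝ) < m := by exact_mod_cast Nat.pos_of_ne_zero hm
  have e1 : (m : ℝ) + 1 = m * (1 + 1 / m) := by field_simp
  have e2 : (m : ℝ) ^ (-(2 * (n : ℝ) - 1)) = m * (1 / (m : ℝ)) ^ (2 * n) := by
    rw [neg_sub, Real.rpow_sub hm', Real.rpow_one, one_div, inv_pow, div_eq_mul_inv,
      ← Real.rpow_natCast]
    push_cast
    rfl
  rw [powDiff, e1, Real.mul_rpow hm'.le (by positivity), e2]
  ring

lemma neg_powDiff_le {n : ℕ} (hn : n ≠ 0) {m : ℕ} (hm : m ≠ 0) :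
    -powDiff (-(2 * (n : ℝ) - 1)) m ≤ 2 * n * (1 / (m : ℝ)) ^ (2 * n) := by
  have hm' : (0 : ℝ) < m := by exact_mod_cast Nat.pos_of_ne_zero hm
  have hn' : (1 : ℝ) ≤ n := by exact_mod_cast Nat.one_le_iff_ne_zero.2 hn
  rw [neg_powDiff_eq n hm]
  refine mul_le_mul_of_nonneg_right ?_ (by positivity)
  have h1 : Real.log (1 + 1 / m) ≤ 1 / m := by
    have := Real.log_le_sub_one_of_pos (x := 1 + 1 / (m : ℝ)) (by positivity)
    linarith
  have h2 : 1 + -(2 * (n : ℝ) - 1) * (1 / m) ≤ (1 + 1 / (m : ℝ)) ^ (-(2 * (n : ℝ) - 1)) := by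
    rw [Real.rpow_def_of_pos (by positivity)]
    have := Real.add_one_le_exp (Real.log (1 + 1 / m) * -(2 * (n : ℝ) - 1))
    nlinarith
  calc (m : ℝ) * (1 - (1 + 1 / (m : ℝ)) ^ (-(2 * (n : ℝ) - 1)))
      ≤ m * ((2 * n - 1) * (1 / m)) := by
        gcongr
        linarith
    _ = 2 * n - 1 := by field_simp
    _ ≤ 2 * n := by linarith

lemma tendsto_mul_one_sub_rpow (β : ℝ) :
    Tendsto (fun m : ℕ => (m : ℝ) * (1 - (1 + 1 / (m : ℝ)) ^ β)) atTop (𝓝 (-β)) := by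
  have h : HasDerivAt (fun x : ℝ => (1 + x) ^ β) β 0 := by
    have := ((hasDerivAt_id (0 : ℝ)).const_add 1).rpow_const (p := β) (Or.inl (by norm_num))
    simpa using this
  have h1 := (hasDerivAt_iff_tendsto_slope_zero.1 h)
  have h2 : Tendsto (fun m : ℕ => 1 / (m : ℝ)) atTop (𝓝[≠] 0) := by
    rw [tendsto_nhdsWithin_iff]
    refine ⟨tendsto_one_div_atTop_nhds_zero_nat, ?_⟩
    filter_upwards [eventually_ne_atTop 0] with m hm
    have : (m : ℝ) ≠ 0 := by exact_mod_cast hm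
    simpa using this
  refine (h1.comp h2).neg.congr fun m => ?_
  simp
  ring

lemma scaledRiem_eq_zero {M : ℕ} (hM : M ≤ 2) (p : ℕ) : scaledRiem M p = 0 := by
  rw [scaledRiem_eq_tsum]
  have : ∀ j, riemTerm M p j = 0 := by
    intro j
    rcases eq_or_ne j 0 with rfl | hj
    · simp [riemTerm, phi]
    · rw [riemTerm, if_neg (by omega), mul_zero]
  simp [this]

/-- The integrand whose integral is the rescaled coefficient for negative exponents. -/
noncomputable def weightedRiem (n p M : ℕ) : ℝ :=
  (p : ℝ) ^ n * -powDiff (-(2 * (n : ℝ) - 1)) (M - 2) * scaledRiem M p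

lemma weightedRiem_nonneg {n : ℕ} (hn : n ≠ 0) (p M : ℕ) : 0 ≤ weightedRiem n p M := by
  have hn' : (1 : ℝ) ≤ n := by exact_mod_cast Nat.one_le_iff_ne_zero.2 hn
  rcases le_or_gt M 2 with h | h
  · rw [weightedRiem, scaledRiem_eq_zero h, mul_zero]
  · have h1 : powDiff (-(2 * (n : ℝ) - 1)) (M - 2) ≤ 0 := powDiff_nonpos (by linarith) (by omega)
    exact mul_nonneg (mul_nonneg (by positivity) (neg_nonneg.2 h1)) (scaledRiem_nonneg _ _)

lemma weightedRiem_samples_le {n : ℕ} (hn : n ≠ 0) (p : ℕ) {t : ℝ} (ht : 0 < t) :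
    weightedRiem n p (samples p t) ≤
      2 * n * (9 ^ n * (1 / t) ^ (2 * n)) * scaledRiem (samples p t) p := by
  have h0 := scaledRiem_nonneg (samples p t) p
  rcases le_or_gt (samples p t) 2 with h | h
  · rw [weightedRiem, scaledRiem_eq_zero h, mul_zero, mul_zero]
  refine mul_le_mul_of_nonneg_right ?_ h0
  set M := samples p t with hM
  have hMt : √p * t ≤ M := le_samples p t
  have hM3 : (3 : ℝ) ≤ M := by exact_mod_cast h
  have e : ((M - 2 : ℕ) : ℝ) = M - 2 := by
    rw [Nat.cast_sub (by omega)]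
    norm_num
  have h1 := neg_powDiff_le hn (m := M - 2) (by omega)
  have h2 : √p * (1 / ((M - 2 : ℕ) : ℝ)) ≤ 3 * (1 / t) := by
    rw [e, mul_one_div, mul_one_div, div_le_div_iff₀ (by linarith) ht]
    linarith
  have e2 : (p : ℝ) ^ n = √p ^ (2 * n) := by rw [pow_mul, Real.sq_sqrt (Nat.cast_nonneg p)]
  calc (p : ℝ) ^ n * -powDiff (-(2 * (n : ℝ) - 1)) (M - 2)
      ≤ (p : ℝ) ^ n * (2 * n * (1 / ((M - 2 : ℕ) : ℝ)) ^ (2 * n)) := by gcongr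
    _ = 2 * n * (√p * (1 / ((M - 2 : ℕ) : ℝ))) ^ (2 * n) := by
      rw [e2, mul_pow]
      ring
    _ ≤ 2 * n * (3 * (1 / t)) ^ (2 * n) := by gcongr
    _ = _ := by
      rw [mul_pow, pow_mul 3]
      norm_num

lemma exists_weightedRiem_le {n : ℕ} (hn : n ≠ 0) : ∃ C : ℝ, ∀ (p : ℕ) (t : ℝ), 0 < t →
    |weightedRiem n p (samples p t)| ≤ C * (1 + t ^ 2)⁻¹ := by
  set a : ℝ := 2 * n * 9 ^ n * (3 * (n + 1 + 1).factorial * zetaEven (n + 1))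
  have hz := zetaEven_nonneg (n + 1)
  refine ⟨2 * (a + 2 * n * 9 ^ n * 21), fun p t ht => ?_⟩
  rw [abs_of_nonneg (weightedRiem_nonneg hn _ _)]
  have h0 := weightedRiem_samples_le hn p ht
  refine le_of_bounds (by positivity) (by positivity) ht (fun h => h0.trans ?_)
    (fun h => h0.trans ?_)
  · have h1 := scaledRiem_samples_le (Nat.succ_ne_zero n) p ht
    calc 2 * n * (9 ^ n * (1 / t) ^ (2 * n)) * scaledRiem (samples p t) p
        ≤ 2 * n * (9 ^ n * (1 / t) ^ (2 * n)) *
          (3 * (n + 1 + 1).factorial * zetaEven (n + 1) * (t ^ (2 * (n + 1)) / t)) := by gcongr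
      _ = a * t := by
        simp only [a]
        rw [one_div, inv_pow]
        field_simp
        ring
      _ ≤ a := mul_le_of_le_one_right (by positivity) h
  · have h1 : scaledRiem (samples p t) p ≤ 21 := by
      have h2 := (abs_le.1 (abs_scaledMean_sub_le p ht)).1
      have h3 := scaledMean_le p
      have h4 : 20 / t ^ 2 ≤ 20 := div_le_self (by norm_num) (one_le_pow₀ h)
      linarith
    have h2 : (1 / t) ^ (2 * n) ≤ (1 / t) ^ 2 :=
      pow_le_pow_of_le_one (by positivity) ((div_le_one ht).2 h) (by omega)
    calc 2 * n * (9 ^ n * (1 / t) ^ (2 * n)) * scaledRiem (samples p t) p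
        ≤ 2 * n * (9 ^ n * (1 / t) ^ 2) * 21 := by
          gcongr
          exact scaledRiem_nonneg _ _
      _ = _ := by
        rw [one_div, inv_pow]
        ring

lemma tendsto_weightedRiem (n : ℕ) {t : ℝ} (ht : 0 < t) :
    Tendsto (fun p : ℕ => weightedRiem n p (samples p t)) atTop
      (𝓝 ((2 * n - 1) * (1 / t) ^ (2 * n) * kernel t)) := by
  have hm : Tendsto (fun p : ℕ => samples p t - 2) atTop atTop :=
    (tendsto_sub_atTop_nat 2).comp (tendsto_samples ht)
  have h1 := (tendsto_mul_one_sub_rpow (-(2 * (n : ℝ) - 1))).comp hm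
  rw [neg_neg] at h1
  have h2 : Tendsto (fun p : ℕ => ((samples p t - 2 : ℕ) : ℝ) / √p) atTop (𝓝 t) := by
    have h3 : Tendsto (fun p : ℕ => (2 : ℝ) / √p) atTop (𝓝 0) :=
      (Real.tendsto_sqrt_atTop.comp tendsto_natCast_atTop_atTop).const_div_atTop _
    have h4 := (tendsto_samples_div_sqrt ht).sub h3
    rw [sub_zero] at h4
    refine h4.congr' ?_
    filter_upwards [(tendsto_samples ht).eventually_ge_atTop 2] with p hp
    rw [Nat.cast_sub hp, sub_div, Nat.cast_ofNat]
  have h3 := ((h2.inv₀ ht.ne').pow (2 * n))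
  rw [← one_div] at h3
  refine ((h1.mul h3).mul (tendsto_scaledRiem ht)).congr' ?_
  filter_upwards [hm.eventually_ne_atTop 0] with p hp
  simp only [Function.comp_apply]
  rw [weightedRiem, neg_powDiff_eq n hp]
  have e2 : (p : ℝ) ^ n = √p ^ (2 * n) := by rw [pow_mul, Real.sq_sqrt (Nat.cast_nonneg p)]
  rw [e2, inv_div, div_pow, one_div, inv_pow]
  ring

open MeasureTheory in
lemma tendsto_coeff_neg {n : ℕ} (hn : n ≠ 0) {Z : ℕ → ℝ}
    (hZ : IsCoeffSeq (-(2 * (n : ℝ) - 1)) Z) :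
    Tendsto (fun p : ℕ => (p : ℝ) ^ (n + 1) * Z (p + 1) / 4 ^ (p + 1)) atTop
      (𝓝 (∫ t in Set.Ioi (0 : ℝ), (2 * n - 1) * (1 / t) ^ (2 * n) * kernel t)) := by
  have hn' : (1 : ℝ) ≤ n := by exact_mod_cast Nat.one_le_iff_ne_zero.2 hn
  obtain ⟨C, hC⟩ := exists_weightedRiem_le hn
  have hbi : IntegrableOn (fun t : ℝ => C * (1 + t ^ 2)⁻¹) (Set.Ioi 0) :=
    (integrable_inv_one_add_sq.const_mul _).integrableOn
  have hbound : ∀ p : ℕ, ∀ᵐ t ∂(volume.restrict (Set.Ioi (0 : ℝ))),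
      ‖weightedRiem n p (samples p t)‖ ≤ C * (1 + t ^ 2)⁻¹ := fun p =>
    (ae_restrict_iff' measurableSet_Ioi).2 (Eventually.of_forall fun t ht => hC p t ht)
  have hmeas : ∀ p : ℕ, AEStronglyMeasurable (fun t => weightedRiem n p (samples p t))
      (volume.restrict (Set.Ioi (0 : ℝ))) := fun p =>
    aestronglyMeasurable_samples (weightedRiem n p) p _
  have hlim := tendsto_integral_of_dominated_convergence _ hmeas hbi hbound
    ((ae_restrict_iff' measurableSet_Ioi).2 (Eventually.of_forall fun t ht =>
      tendsto_weightedRiem n ht))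
  refine hlim.congr' ?_
  filter_upwards [eventually_ne_atTop 0] with p hp
  have hp' : (0 : ℝ) < p := by exact_mod_cast Nat.pos_of_ne_zero hp
  have hs : 0 < √(p : ℝ) := Real.sqrt_pos.2 hp'
  have hint : IntegrableOn (fun t => weightedRiem n p (samples p t)) (Set.Ioi 0) :=
    Integrable.mono' hbi (hmeas p) (hbound p)
  have h1 := integral_samples hp (weightedRiem n p) hint
  rw [← hasSum_nat_add_iff' 1, Finset.sum_range_one, weightedRiem,
    scaledRiem_eq_zero (by norm_num), mul_zero, sub_zero] at h1
  have h2 := (h1.mul_left (2 / ((p : ℝ) ^ n * (p * √p)))).tsum_eq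
  rw [coeff_eq_tsum_of_neg (by linarith) hZ p]
  have h3 : ∑' m : ℕ, -powDiff (-(2 * (n : ℝ) - 1)) m * riem (m + 2) p =
      ∑' m : ℕ, 2 / ((p : ℝ) ^ n * (p * √p)) * weightedRiem n p (m + 1 + 1) := by
    congr 1
    funext m
    rw [weightedRiem, scaledRiem]
    have : m + 1 + 1 - 2 = m := rfl
    rw [this]
    field_simp
  rw [h3, h2]
  field_simp
  ring

lemma integral_inv_pow_mul_exp (n : ℕ) {c : ℝ} (hc : 0 < c) :
    ∫ t in Set.Ioi (0 : ℝ), (1 / t) ^ (2 * n + 3) * Real.exp (-(c / t ^ 2)) =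
      n.factorial / (2 * c ^ (n + 1)) := by
  have h1 := MeasureTheory.integral_comp_rpow_Ioi
    (fun y : ℝ => y ^ ((n + 1 : ℝ) - 1) * Real.exp (-(c * y))) (p := -2) (by norm_num)
  rw [Real.integral_rpow_mul_exp_neg_mul_Ioi (by positivity) hc, Real.Gamma_nat_eq_factorial] at h1
  have h2 : ∫ t in Set.Ioi (0 : ℝ), (1 / t) ^ (2 * n + 3) * Real.exp (-(c / t ^ 2)) =
      2⁻¹ * ∫ x in Set.Ioi (0 : ℝ), (|(-2 : ℝ)| * x ^ ((-2 : ℝ) - 1)) •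
        ((x ^ (-2 : ℝ)) ^ ((n + 1 : ℝ) - 1) * Real.exp (-(c * x ^ (-2 : ℝ)))) := by
    rw [← MeasureTheory.integral_const_mul]
    refine MeasureTheory.setIntegral_congr_fun measurableSet_Ioi fun x hx => ?_
    have hx' : (0 : ℝ) < x := hx
    have e1 : x ^ (-2 : ℝ) = (1 / x) ^ 2 := by
      rw [Real.rpow_neg hx'.le, one_div, inv_pow]
      norm_cast
    have e2 : x ^ ((-2 : ℝ) - 1) = (1 / x) ^ 3 := by
      rw [(by norm_num : (-2 : ℝ) - 1 = -(3 : ℕ)), Real.rpow_neg hx'.le, one_div, inv_pow,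
        Real.rpow_natCast]
    simp only [smul_eq_mul]
    rw [e1, e2, add_sub_cancel_right, Real.rpow_natCast, abs_neg, abs_two, ← pow_mul]
    have e3 : c * (1 / x) ^ 2 = c / x ^ 2 := by rw [one_div, inv_pow, div_eq_mul_inv]
    rw [e3]
    ring
  rw [h2, h1]
  have : (1 / c) ^ ((n : ℝ) + 1) = 1 / c ^ (n + 1) := by
    rw [one_div, one_div, ← inv_pow]
    exact_mod_cast Real.rpow_natCast c⁻¹ (n + 1)
  rw [this]
  field_simp

open MeasureTheory in
lemma integral_kernel_weight {n : ℕ} (hn : n ≠ 0) :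
    ∫ t in Set.Ioi (0 : ℝ), (2 * n - 1) * (1 / t) ^ (2 * n) * kernel t =
      (2 * n - 1) * n.factorial / (2 * Real.pi ^ (2 * n)) * zetaEven n := by
  have hpi := Real.pi_pos
  have hn' : (1 : ℝ) ≤ n := by exact_mod_cast Nat.one_le_iff_ne_zero.2 hn
  set F : ℕ → ℝ → ℝ := fun j t => (2 * n - 1) * (1 / t) ^ (2 * n) * kernelTerm t j with hF
  set I : ℕ → ℝ := fun j =>
    (2 * n - 1) * n.factorial / (2 * Real.pi ^ (2 * n)) * (1 / (j : ℝ) ^ (2 * n)) with hI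
  have hint : ∀ j, ∫ t in Set.Ioi (0 : ℝ), F j t = I j := by
    intro j
    rcases eq_or_ne j 0 with rfl | hj
    · simp [hF, hI, kernelTerm, hn]
    have hj' : (0 : ℝ) < j := by exact_mod_cast Nat.pos_of_ne_zero hj
    have e : ∫ t in Set.Ioi (0 : ℝ), F j t = (2 * n - 1) * (Real.pi * j) ^ 2 *
        ∫ t in Set.Ioi (0 : ℝ), (1 / t) ^ (2 * n + 3) *
          Real.exp (-((Real.pi * j) ^ 2 / t ^ 2)) := by
      rw [← integral_const_mul]
      refine setIntegral_congr_fun measurableSet_Ioi fun t ht => ?_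
      simp only [hF, kernelTerm, div_pow]
      ring
    rw [e, integral_inv_pow_mul_exp n (by positivity)]
    simp only [hI]
    rw [← pow_mul, mul_pow, mul_pow]
    field_simp
    ring
  have hFint : ∀ j, IntegrableOn (F j) (Set.Ioi 0) := by
    intro j
    rcases eq_or_ne j 0 with rfl | hj
    · simp [hF, kernelTerm]
    refine Integrable.of_integral_ne_zero ?_
    rw [hint j]
    have hj' : (0 : ℝ) < j := by exact_mod_cast Nat.pos_of_ne_zero hj
    have h1 : (0 : ℝ) < 2 * n - 1 := by linarith
    simp only [hI]
    positivity
  have hnorm : ∀ j, ∫ t in Set.Ioi (0 : ℝ), ‖F j t‖ = I j := by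
    intro j
    rw [← hint j]
    refine setIntegral_congr_fun measurableSet_Ioi fun t ht => ?_
    have ht' : (0 : ℝ) < t := ht
    have h1 : (0 : ℝ) ≤ 2 * n - 1 := by linarith
    rw [Real.norm_eq_abs, abs_of_nonneg]
    exact mul_nonneg (by positivity) (kernelTerm_nonneg ht' j)
  have hIs : Summable I := (summable_inv_even_pow hn).mul_left _
  have h := hasSum_integral_of_summable_integral_norm hFint (hIs.congr fun j => (hnorm j).symm)
  have h2 : ∑' j, ∫ t in Set.Ioi (0 : ℝ), F j t =
      (2 * n - 1) * n.factorial / (2 * Real.pi ^ (2 * n)) * zetaEven n := by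
    rw [zetaEven, ← tsum_mul_left]
    exact tsum_congr hint
  rw [← h2, h.tsum_eq]
  congr 1
  funext t
  simp only [hF, kernel, tsum_mul_left]

/-- The one-sided theta series `∑_{j ≥ 1} exp (-s j²)`. -/
noncomputable def thetaHalf (s : ℝ) : ℝ := ∑' j : ℕ, Real.exp (-(s * ((j : ℝ) + 1) ^ 2))

lemma summable_inv_succ_sq : Summable fun j : ℕ => 1 / ((j : ℝ) + 1) ^ 2 := by
  have := (summable_nat_add_iff 1).2 (Real.summable_one_div_nat_pow.2 one_lt_two)
  exact_mod_cast this

lemma exp_neg_le_inv {y : ℝ} (hy : 0 < y) : Real.exp (-y) ≤ 1 / y := by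
  have := pow_mul_exp_neg_le 1 hy.le
  rw [le_div_iff₀ hy]
  simpa [mul_comm] using this

lemma theta_term_le {s : ℝ} (hs : 0 < s) (j : ℕ) :
    Real.exp (-(s * ((j : ℝ) + 1) ^ 2)) ≤ 1 / s * (1 / ((j : ℝ) + 1) ^ 2) :=
  (exp_neg_le_inv (by positivity)).trans (le_of_eq (by rw [one_div_mul_one_div]))

lemma summable_theta {s : ℝ} (hs : 0 < s) :
    Summable fun j : ℕ => Real.exp (-(s * ((j : ℝ) + 1) ^ 2)) :=
  Summable.of_nonneg_of_le (fun _ => (Real.exp_pos _).le) (theta_term_le hs)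
    (summable_inv_succ_sq.mul_left _)

lemma thetaHalf_nonneg (s : ℝ) : 0 ≤ thetaHalf s := tsum_nonneg fun _ => (Real.exp_pos _).le

lemma thetaHalf_le {s : ℝ} (hs : 0 < s) :
    thetaHalf s ≤ 1 / s * ∑' j : ℕ, 1 / ((j : ℝ) + 1) ^ 2 := by
  rw [← tsum_mul_left]
  exact (summable_theta hs).tsum_le_tsum (theta_term_le hs) (summable_inv_succ_sq.mul_left _)

lemma tsum_int_theta {s : ℝ} (hs : 0 < s) :
    ∑' n : ℤ, Real.exp (-(s * (n : ℝ) ^ 2)) = 1 + 2 * thetaHalf s := by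
  have h := (summable_theta hs).hasSum
  have h1 := HasSum.of_add_one_of_neg_add_one (f := fun n : ℤ => Real.exp (-(s * (n : ℝ) ^ 2)))
    (m := thetaHalf s) (m' := thetaHalf s)
    (h.congr_both (by funext j; push_cast; rfl) rfl)
    (h.congr_both (by funext j; push_cast; congr 3; ring) rfl)
  rw [h1.tsum_eq]
  simp
  ring

lemma theta_functional_equation {t : ℝ} (ht : 0 < t) :
    1 + 2 * thetaHalf (Real.pi ^ 2 / t ^ 2) = t / √Real.pi * (1 + 2 * thetaHalf (t ^ 2)) := by
  have hpi := Real.pi_pos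
  have h := Real.tsum_exp_neg_mul_int_sq (a := t ^ 2 / Real.pi) (by positivity)
  have e1 : ∀ n : ℤ, -Real.pi * (t ^ 2 / Real.pi) * (n : ℝ) ^ 2 = -(t ^ 2 * (n : ℝ) ^ 2) := by
    intro n
    field_simp
  have e2 : ∀ n : ℤ, -Real.pi / (t ^ 2 / Real.pi) * (n : ℝ) ^ 2 =
      -(Real.pi ^ 2 / t ^ 2 * (n : ℝ) ^ 2) := by
    intro n
    field_simp
  simp only [e1, e2] at h
  rw [tsum_int_theta (by positivity), tsum_int_theta (by positivity), ← Real.sqrt_eq_rpow,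
    Real.sqrt_div (by positivity), Real.sqrt_sq ht.le] at h
  rw [h]
  have : 0 < √Real.pi := Real.sqrt_pos.2 hpi
  field_simp

lemma kernel_eq_succ (t : ℝ) : kernel t = ∑' j : ℕ, kernelTerm t (j + 1) := by
  by_cases h : Summable (kernelTerm t)
  · rw [kernel, h.tsum_eq_zero_add]
    simp [kernelTerm]
  · rw [kernel, tsum_eq_zero_of_not_summable h, tsum_eq_zero_of_not_summable]
    rwa [summable_nat_add_iff 1]

lemma hasDerivAt_thetaHalf {t : ℝ} (ht : 0 < t) :
    HasDerivAt (fun x => thetaHalf (Real.pi ^ 2 / x ^ 2) / 2) (kernel t) t := by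
  have hpi := Real.pi_pos
  have h := hasDerivAt_tsum_of_isPreconnected
    (u := fun j : ℕ => 4 * t * (1 / ((j : ℝ) + 1) ^ 2))
    (g := fun (j : ℕ) (x : ℝ) => Real.exp (-(Real.pi ^ 2 / x ^ 2 * ((j : ℝ) + 1) ^ 2)))
    (g' := fun (j : ℕ) (x : ℝ) => 2 * kernelTerm x (j + 1))
    (t := Set.Ioo 0 (2 * t)) (y₀ := t) (y := t) (summable_inv_succ_sq.mul_left _) isOpen_Ioo
    isPreconnected_Ioo ?_ ?_ ⟨ht, by linarith⟩ (summable_theta (by positivity)) ⟨ht, by linarith⟩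
  · have h2 := h.div_const 2
    rw [tsum_mul_left, ← kernel_eq_succ, mul_div_cancel_left₀ _ two_ne_zero] at h2
    exact h2
  · rintro j x ⟨hx, -⟩
    have h1 : HasDerivAt (fun x : ℝ => -(Real.pi ^ 2 / x ^ 2 * ((j : ℝ) + 1) ^ 2))
        (2 * Real.pi ^ 2 * ((j : ℝ) + 1) ^ 2 / x ^ 3) x := by
      have := ((((hasDerivAt_pow 2 x).inv (by positivity)).const_mul (Real.pi ^ 2)).mul_const
        (((j : ℝ) + 1) ^ 2)).neg
      refine (this.congr_of_eventuallyEq ?_).congr_deriv ?_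
      · exact Eventually.of_forall fun y => by simp [div_eq_mul_inv]
      · field_simp
        norm_num
        ring
    refine h1.exp.congr_deriv ?_
    simp only [kernelTerm]
    push_cast
    have e : (Real.pi * ((j : ℝ) + 1) / x) ^ 2 = Real.pi ^ 2 / x ^ 2 * ((j : ℝ) + 1) ^ 2 := by
      rw [div_pow, mul_pow]
      ring
    rw [e]
    field_simp
  · rintro j x ⟨hx, hx2⟩
    have h0 := kernelTerm_nonneg hx (j + 1)
    rw [Real.norm_eq_abs, abs_of_nonneg (by positivity)]
    simp only [kernelTerm]
    push_cast
    set y := Real.pi * ((j : ℝ) + 1) / x with hy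
    have hypos : 0 < y := by positivity
    have h1 := pow_mul_exp_neg_le 2 (y := y ^ 2) (by positivity)
    have h2 : y ^ 2 * Real.exp (-y ^ 2) ≤ 2 / y ^ 2 := by
      rw [le_div_iff₀ (by positivity)]
      norm_num [Nat.factorial] at h1
      nlinarith
    have h3 : 2 / y ^ 2 ≤ x ^ 2 * (1 / ((j : ℝ) + 1) ^ 2) := by
      rw [hy, div_pow, mul_pow]
      have : (2 : ℝ) ≤ Real.pi ^ 2 := by nlinarith [Real.pi_gt_three]
      rw [mul_one_div, div_le_div_iff₀ (by positivity) (by positivity)]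
      field_simp
      exact this
    calc 2 * (1 / x * (y ^ 2 * Real.exp (-y ^ 2)))
        ≤ 2 * (1 / x * (x ^ 2 * (1 / ((j : ℝ) + 1) ^ 2))) := by
          have := h2.trans h3
          gcongr 2 * (1 / x * ?_)
      _ = 2 * x * (1 / ((j : ℝ) + 1) ^ 2) := by field_simp
      _ ≤ 2 * (2 * t) * (1 / ((j : ℝ) + 1) ^ 2) := by gcongr
      _ = _ := by ring

open MeasureTheory in
lemma integral_mean_sub_kernel {κ : ℝ} (hκ : Tendsto scaledMean atTop (𝓝 κ)) :
    ∫ t in Set.Ioi (0 : ℝ), (κ - kernel t) = 1 / 4 := by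
  have hpi := Real.pi_pos
  have hspi : 0 < √Real.pi := Real.sqrt_pos.2 hpi
  have hint : IntegrableOn (fun t => κ - kernel t) (Set.Ioi 0) := by
    refine Integrable.mono' (g := fun t : ℝ => 2 * (1 + 6 * zetaEven 1 + 20) * (1 + t ^ 2)⁻¹)
      (integrable_inv_one_add_sq.const_mul _).integrableOn ?_ ?_
    · refine aestronglyMeasurable_of_tendsto_ae atTop (f := fun (p : ℕ) t =>
        scaledMean p - scaledRiem (samples p t) p)
        (fun p => aestronglyMeasurable_samples (fun M => scaledMean p - scaledRiem M p) p _) ?_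
      exact (ae_restrict_iff' measurableSet_Ioi).2 (Eventually.of_forall fun t ht =>
        hκ.sub (tendsto_scaledRiem ht))
    · exact (ae_restrict_iff' measurableSet_Ioi).2 (Eventually.of_forall fun t ht =>
        le_of_tendsto (hκ.sub (tendsto_scaledRiem ht)).abs
          (Eventually.of_forall fun p => abs_scaledMean_sub_samples_le p ht))
  set G : ℝ → ℝ := fun t => κ * t - thetaHalf (Real.pi ^ 2 / t ^ 2) / 2 with hG
  set B : ℝ := ∑' j : ℕ, 1 / ((j : ℝ) + 1) ^ 2 with hB
  have hG0 : G 0 = 0 := by simp [hG, thetaHalf]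
  have hder : ∀ t ∈ Set.Ioi (0 : ℝ), HasDerivAt G (κ - kernel t) t := by
    intro t ht
    have := ((hasDerivAt_id t).const_mul κ).sub (hasDerivAt_thetaHalf ht)
    rw [mul_one] at this
    exact this
  have hcont : ContinuousWithinAt G (Set.Ici 0) 0 := by
    have hth : Tendsto (fun t : ℝ => thetaHalf (Real.pi ^ 2 / t ^ 2) / 2) (𝓝[Set.Ici 0] 0)
        (𝓝 0) := by
      have hu : Tendsto (fun t : ℝ => t ^ 2 / Real.pi ^ 2 * B / 2) (𝓝[Set.Ici 0] 0) (𝓝 0) := by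
        have : Continuous fun t : ℝ => t ^ 2 / Real.pi ^ 2 * B / 2 := by fun_prop
        have h := this.tendsto 0
        norm_num at h
        exact h.mono_left nhdsWithin_le_nhds
      refine tendsto_of_tendsto_of_tendsto_of_le_of_le' tendsto_const_nhds hu
        (Eventually.of_forall fun t => by
          have := thetaHalf_nonneg (Real.pi ^ 2 / t ^ 2)
          positivity)
        ?_
      filter_upwards [self_mem_nhdsWithin] with t ht
      rcases eq_or_lt_of_le (show (0 : ℝ) ≤ t from ht) with h | h
      · simp [← h, thetaHalf]
      · have := thetaHalf_le (s := Real.pi ^ 2 / t ^ 2) (by positivity)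
        rw [one_div_div] at this
        linarith
    have hlin : Tendsto (fun t : ℝ => κ * t) (𝓝[Set.Ici 0] 0) (𝓝 0) := by
      have := (continuous_const_mul κ).tendsto (0 : ℝ)
      rw [mul_zero] at this
      exact this.mono_left nhdsWithin_le_nhds
    have := hlin.sub hth
    rw [ContinuousWithinAt, hG0]
    rwa [sub_zero] at this
  have hGeq : ∀ t : ℝ, 0 < t → G t = (κ - 1 / (4 * √Real.pi)) * t + 1 / 4 -
      t * thetaHalf (t ^ 2) / (2 * √Real.pi) := by
    intro t ht
    have h := theta_functional_equation ht
    have : thetaHalf (Real.pi ^ 2 / t ^ 2) =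
      (t / √Real.pi * (1 + 2 * thetaHalf (t ^ 2)) - 1) / 2 := by linarith
    simp only [hG]
    rw [this]
    field_simp
    ring
  have hsmall : Tendsto (fun t : ℝ => t * thetaHalf (t ^ 2) / (2 * √Real.pi)) atTop (𝓝 0) := by
    have hu : Tendsto (fun t : ℝ => B / (2 * √Real.pi) / t) atTop (𝓝 0) :=
      tendsto_id.const_div_atTop _
    refine tendsto_of_tendsto_of_tendsto_of_le_of_le' tendsto_const_nhds hu ?_ ?_
    · filter_upwards [eventually_gt_atTop 0] with t ht
      have := thetaHalf_nonneg (t ^ 2)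
      positivity
    · filter_upwards [eventually_gt_atTop 0] with t ht
      have := thetaHalf_le (s := t ^ 2) (by positivity)
      calc t * thetaHalf (t ^ 2) / (2 * √Real.pi)
          ≤ t * (1 / t ^ 2 * B) / (2 * √Real.pi) := by gcongr
        _ = _ := by field_simp
  have hlim := tendsto_limUnder_of_hasDerivAt_of_integrableOn_Ioi hder hint
  have hκeq : κ - 1 / (4 * √Real.pi) = 0 := by
    have h1 : Tendsto (fun t : ℝ => G t / t) atTop (𝓝 0) := hlim.div_atTop tendsto_id
    have h2 : Tendsto (fun t : ℝ => G t / t) atTop (𝓝 (κ - 1 / (4 * √Real.pi))) := by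
      have h3 : Tendsto (fun t : ℝ => (κ - 1 / (4 * √Real.pi)) + (1 / 4 -
          t * thetaHalf (t ^ 2) / (2 * √Real.pi)) / t) atTop (𝓝 ((κ - 1 / (4 * √Real.pi)) + 0)) :=
        tendsto_const_nhds.add ((tendsto_const_nhds.sub hsmall).div_atTop tendsto_id)
      rw [add_zero] at h3
      refine h3.congr' ?_
      filter_upwards [eventually_gt_atTop 0] with t ht
      rw [hGeq t ht]
      field_simp
      ring
    exact tendsto_nhds_unique h2 h1
  have hGlim : Tendsto G atTop (𝓝 (1 / 4)) := by
    have h3 : Tendsto (fun t : ℝ => 1 / 4 - t * thetaHalf (t ^ 2) / (2 * √Real.pi)) atTop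
        (𝓝 (1 / 4 - 0)) := tendsto_const_nhds.sub hsmall
    rw [sub_zero] at h3
    refine h3.congr' ?_
    filter_upwards [eventually_gt_atTop 0] with t ht
    rw [hGeq t ht, hκeq]
    ring
  rw [integral_Ioi_of_hasDerivAt_of_tendsto hcont hder hint hGlim, hG0, sub_zero]

lemma hasDerivAt_pi_mul_cot {z : ℂ} (hz : Complex.sin (Real.pi * z) ≠ 0) :
    HasDerivAt (fun x : ℂ => Real.pi * Complex.cot (Real.pi * x))
      (-(Real.pi ^ 2 / Complex.sin (Real.pi * z) ^ 2)) z := by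
  have hl : HasDerivAt (fun x : ℂ => (Real.pi : ℂ) * x) Real.pi z := by
    simpa using (hasDerivAt_id z).const_mul (Real.pi : ℂ)
  have hcos := (Complex.hasDerivAt_cos (Real.pi * z)).comp z hl
  have hsin := (Complex.hasDerivAt_sin (Real.pi * z)).comp z hl
  have h := (hcos.div hsin hz).const_mul (Real.pi : ℂ)
  refine h.congr_deriv ?_
  have := Complex.sin_sq_add_cos_sq (Real.pi * z)
  simp only [Function.comp_apply]
  field_simp
  linear_combination -this

lemma hasSum_sq_div_sinh_sq {t : ℝ} (ht : 0 < t) :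
    HasSum (fun n : ℕ => t ^ 2 * ((Real.pi * (n + 1)) ^ 2 - t ^ 2) /
      ((Real.pi * (n + 1)) ^ 2 + t ^ 2) ^ 2) ((1 - t ^ 2 / Real.sinh t ^ 2) / 2) := by
  have hpi := Real.pi_pos
  have hpiC : (Real.pi : ℂ) ≠ 0 := by exact_mod_cast hpi.ne'
  have htC : (t : ℂ) ≠ 0 := by exact_mod_cast ht.ne'
  have hsinh : (Complex.sinh t) ≠ 0 := by
    rw [← Complex.ofReal_sinh]
    exact_mod_cast (Real.sinh_pos_iff.2 ht).ne'
  set z : ℂ := ((t / Real.pi : ℝ) : ℂ) * Complex.I with hz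
  have hzmem : z ∈ UpperHalfPlane.upperHalfPlaneSet := by
    simp only [UpperHalfPlane.upperHalfPlaneSet, Set.mem_ofPred_eq, hz]
    simp
    positivity
  have hpz : (Real.pi : ℂ) * z = t * Complex.I := by
    rw [hz]
    push_cast
    field_simp
  have hsin : Complex.sin (Real.pi * z) = Complex.sinh t * Complex.I := by
    rw [hpz, Complex.sin_mul_I]
  have hsin0 : Complex.sin (Real.pi * z) ≠ 0 := by
    rw [hsin]
    exact mul_ne_zero hsinh Complex.I_ne_zero
  have hcot := iteratedDerivWithin_cot_pi_mul_eq_mul_tsum_div_pow (k := 1) le_rfl hzmem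
  rw [iteratedDerivWithin_one,
    derivWithin_of_isOpen UpperHalfPlane.isOpen_upperHalfPlaneSet hzmem,
    (hasDerivAt_pi_mul_cot hsin0).deriv, hsin] at hcot
  have hsum : Summable fun n : ℤ => 1 / (z + n) ^ (1 + 1) := by
    refine (EisensteinSeries.linear_right_summable z 1 (k := 2) le_rfl).congr fun n => ?_
    rw [one_div]
    norm_cast
    simp
  have h1 : Summable fun n : ℕ => 1 / (z + ((n + 1 : ℤ) : ℂ)) ^ (1 + 1) :=
    hsum.comp_injective (i := fun n : ℕ => (n + 1 : ℤ)) fun a b h => by simpa using h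
  have h2 : Summable fun n : ℕ => 1 / (z + ((-(n + 1) : ℤ) : ℂ)) ^ (1 + 1) :=
    hsum.comp_injective (i := fun n : ℕ => (-(n + 1) : ℤ)) fun a b h => by simpa using h
  have hsplit := tsum_of_add_one_of_neg_add_one (f := fun n : ℤ => 1 / (z + n) ^ (1 + 1)) h1 h2
  rw [hsplit] at hcot
  have hterm := (h1.hasSum.add h2.hasSum).mul_left ((t : ℂ) ^ 2 / (2 * Real.pi ^ 2))
  have hI := Complex.I_sq
  set S₁ := ∑' n : ℕ, 1 / (z + ((n + 1 : ℤ) : ℂ)) ^ (1 + 1)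
  set S₂ := ∑' n : ℕ, 1 / (z + ((-(n + 1) : ℤ) : ℂ)) ^ (1 + 1)
  have hval : (t : ℂ) ^ 2 / (2 * Real.pi ^ 2) * (S₁ + S₂) =
      (((1 - t ^ 2 / Real.sinh t ^ 2) / 2 : ℝ) : ℂ) := by
    have e0 : z + ((0 : ℤ) : ℂ) = t / Real.pi * Complex.I := by
      rw [hz]
      push_cast
      ring
    rw [e0, mul_pow, mul_pow, hI, Nat.factorial_one] at hcot
    push_cast at hcot ⊢
    have hS : S₁ + S₂ = Real.pi ^ 2 / t ^ 2 - Real.pi ^ 2 / Complex.sinh t ^ 2 := by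
      field_simp at hcot ⊢
      linear_combination hcot
    rw [hS]
    field_simp
  rw [hval] at hterm
  rw [← Complex.hasSum_ofReal]
  refine hterm.congr_both (funext fun n => ?_) rfl
  have hm : (0 : ℝ) < (Real.pi * (n + 1)) ^ 2 + t ^ 2 := by positivity
  have hmC : ((Real.pi : ℂ) * (n + 1)) ^ 2 + t ^ 2 ≠ 0 := by exact_mod_cast hm.ne'
  have hprod : ((Real.pi : ℂ) * (n + 1) + t * Complex.I) *
      (Real.pi * (n + 1) - t * Complex.I) = (Real.pi * (n + 1)) ^ 2 + t ^ 2 := by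
    linear_combination -(t : ℂ) ^ 2 * hI
  have ha : (Real.pi : ℂ) * (n + 1) + t * Complex.I ≠ 0 :=
    fun h => hmC (by rw [← hprod, h, zero_mul])
  have hb : (Real.pi : ℂ) * (n + 1) - t * Complex.I ≠ 0 :=
    fun h => hmC (by rw [← hprod, h, mul_zero])
  have e1 : z + ((n + 1 : ℤ) : ℂ) = (Real.pi * (n + 1) + t * Complex.I) / Real.pi := by
    rw [hz]
    push_cast
    field_simp
    ring
  have e2 : z + ((-(n + 1) : ℤ) : ℂ) = -(Real.pi * (n + 1) - t * Complex.I) / Real.pi := by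
    rw [hz]
    push_cast
    field_simp
    ring
  rw [e1, e2]
  push_cast
  rw [← hprod]
  field_simp
  linear_combination (-2 * (t : ℂ) ^ 2) * hI

lemma hasSum_alternating_odd_mul_pow {y : ℝ} (hy0 : 0 ≤ y) (hy1 : y < 1) :
    HasSum (fun k : ℕ => (-1) ^ k * (2 * k + 1) * y ^ (k + 1)) (y * (1 - y) / (1 + y) ^ 2) := by
  have hn : ‖-y‖ < 1 := by rwa [norm_neg, Real.norm_eq_abs, abs_of_nonneg hy0]
  have h := (((hasSum_coe_mul_geometric_of_norm_lt_one hn).mul_left 2).add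
    (hasSum_geometric_of_norm_lt_one hn)).mul_left y
  refine h.congr_both (funext fun k => ?_) ?_
  · rw [neg_pow y k]
    ring
  · have : 1 + y ≠ 0 := by positivity
    rw [sub_neg_eq_add]
    field_simp
    ring

lemma hasSum_inv_succ_pow (k : ℕ) :
    HasSum (fun n : ℕ => 1 / ((n : ℝ) + 1) ^ (2 * (k + 1))) (zetaEven (k + 1)) := by
  have h := (summable_inv_even_pow (Nat.succ_ne_zero k)).hasSum
  have h1 := (hasSum_nat_add_iff' 1).2 h
  refine h1.congr_both (funext fun n => by push_cast; rfl) ?_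
  simp [zetaEven]

lemma summable_double_series {q : ℝ} (hq0 : 0 ≤ q) (hq1 : q < 1) :
    Summable fun p : ℕ × ℕ =>
      (-1) ^ p.2 * (2 * (p.2 : ℝ) + 1) * (q / ((p.1 : ℝ) + 1) ^ 2) ^ (p.2 + 1) := by
  have hn : ‖q‖ < 1 := by rwa [Real.norm_eq_abs, abs_of_nonneg hq0]
  have hk : Summable fun k : ℕ => (2 * (k : ℝ) + 1) * q ^ (k + 1) := by
    have h := (((hasSum_coe_mul_geometric_of_norm_lt_one hn).mul_left 2).add
      (hasSum_geometric_of_norm_lt_one hn)).mul_left q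
    exact h.summable.congr fun k => by ring
  refine (summable_inv_succ_sq.mul_of_nonneg hk (fun _ => by positivity)
    fun _ => by positivity).of_norm_bounded fun p => ?_
  have h1 : (1 : ℝ) ≤ ((p.1 : ℝ) + 1) ^ 2 := by nlinarith [(Nat.cast_nonneg p.1 : (0 : ℝ) ≤ p.1)]
  have h2 : ((p.1 : ℝ) + 1) ^ 2 ≤ (((p.1 : ℝ) + 1) ^ 2) ^ (p.2 + 1) :=
    le_self_pow₀ h1 (Nat.succ_ne_zero _)
  rw [norm_mul, norm_mul, norm_pow, norm_neg, norm_one, one_pow, one_mul,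
    Real.norm_of_nonneg (by positivity), Real.norm_of_nonneg (by positivity), div_pow]
  calc (2 * (p.2 : ℝ) + 1) * (q ^ (p.2 + 1) / (((p.1 : ℝ) + 1) ^ 2) ^ (p.2 + 1))
      ≤ (2 * (p.2 : ℝ) + 1) * (q ^ (p.2 + 1) / ((p.1 : ℝ) + 1) ^ 2) := by gcongr
    _ = _ := by ring

lemma hasSum_zetaEven_series {t : ℝ} (ht : 0 < t) (htp : t < Real.pi) :
    HasSum (fun k : ℕ => (-1) ^ k * (2 * (k : ℝ) + 1) * (t ^ 2 / Real.pi ^ 2) ^ (k + 1) *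
      zetaEven (k + 1)) ((1 - t ^ 2 / Real.sinh t ^ 2) / 2) := by
  have hpi := Real.pi_pos
  set q := t ^ 2 / Real.pi ^ 2 with hq
  have hq0 : 0 ≤ q := by positivity
  have hq1 : q < 1 := by
    rw [hq, div_lt_one (by positivity)]
    gcongr
  have hS := (summable_double_series hq0 hq1).hasSum
  have hrow (n : ℕ) := hasSum_alternating_odd_mul_pow
    (y := q / ((n : ℝ) + 1) ^ 2) (by positivity) (by
    rw [div_lt_one (by positivity)]
    nlinarith [(Nat.cast_nonneg n : (0 : ℝ) ≤ n)])
  have hval := (hS.prod_fiberwise hrow).unique ((hasSum_sq_div_sinh_sq ht).congr_both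
    (funext fun n => by
      rw [hq]
      have : (Real.pi * ((n : ℝ) + 1)) ^ 2 + t ^ 2 ≠ 0 := by positivity
      have h2 : (Real.pi ^ 2 * ((n : ℝ) + 1) ^ 2) + t ^ 2 ≠ 0 := by positivity
      have h3 : ((n : ℝ) + 1) ≠ 0 := by positivity
      field_simp) rfl)
  rw [hval] at hS
  have hswap := ((Equiv.prodComm ℕ ℕ).hasSum_iff.2 hS)
  refine hswap.prod_fiberwise fun k => ?_
  refine ((hasSum_inv_succ_pow k).mul_left
    ((-1) ^ k * (2 * (k : ℝ) + 1) * q ^ (k + 1))).congr_both (funext fun n => ?_) rfl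
  simp only [Function.comp_apply, Equiv.prodComm_apply, Prod.swap]
  rw [div_pow, pow_mul]
  ring

lemma IsLaurentA.apply_succ {A : ℕ → ℝ} (hA : IsLaurentA A) (k : ℕ) :
    A (k + 1) = -(2 * (-1) ^ k * (2 * (k : ℝ) + 1) * zetaEven (k + 1) /
      (2 * Real.pi) ^ (2 * (k + 1))) := by
  have hpi := Real.pi_pos
  have hzero := coeff_eq_zero_of_hasSum_zero (d := fun k => A (k + 1) +
    2 * (-1) ^ k * (2 * (k : ℝ) + 1) * zetaEven (k + 1) / (2 * Real.pi) ^ (2 * (k + 1)))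
    one_pos (fun x hx hx1 => ?_) k
  · linarith
  have hx' := Real.sqrt_pos.2 hx
  have hsq := Real.sq_sqrt hx.le
  have hxle : √x ≤ 1 := Real.sqrt_le_one.2 hx1.le
  set t := √x / 2 with ht
  have ht0 : 0 < t := by positivity
  have htp : t < Real.pi := by linarith [Real.pi_gt_three]
  have htx : (2 * t) ^ 2 = x := by
    rw [ht]
    linarith
  have h1 := hA.2 t ht0.ne' (by rwa [abs_of_pos ht0])
  have h2 := (hasSum_zetaEven_series ht0 htp).mul_left 2
  have h3 := (h1.add h2).mul_left x⁻¹
  have hs : Real.sinh t ≠ 0 := (Real.sinh_pos_iff.2 ht0).ne'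
  refine h3.congr_both (funext fun j => ?_) ?_
  · rw [pow_mul (2 * t), htx, mul_pow 2 Real.pi, pow_mul 2 2, pow_mul Real.pi 2,
      show t ^ 2 / Real.pi ^ 2 = x / (2 ^ 2 * Real.pi ^ 2) by rw [← htx]; field_simp,
      div_pow, mul_pow]
    field_simp
    ring
  · have hc : Real.cosh (2 * t) - 1 = 2 * Real.sinh t ^ 2 := by
      rw [Real.cosh_two_mul, Real.cosh_sq]
      ring
    rw [hc]
    field_simp
    ring

lemma tendsto_div_rpow_of_tendsto_shift {Z : ℕ → ℝ} {L : ℝ} (n : ℕ)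
    (h : Tendsto (fun p : ℕ => (p : ℝ) ^ (n + 1) * Z (p + 1) / 4 ^ (p + 1)) atTop (𝓝 L)) :
    Tendsto (fun N : ℕ => Z N / ((N : ℝ) ^ (-((n : ℝ) + 1)) * 4 ^ N)) atTop (𝓝 L) := by
  rw [← tendsto_add_atTop_iff_nat 1]
  have hratio : Tendsto (fun p : ℕ => (1 + 1 / (p : ℝ)) ^ (n + 1)) atTop (𝓝 1) := by
    simpa using (tendsto_one_div_atTop_nhds_zero_nat (𝕜 := ℝ)).const_add 1 |>.pow (n + 1)
  have hmul := hratio.mul h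
  rw [one_mul] at hmul
  refine hmul.congr' ?_
  filter_upwards [eventually_gt_atTop 0] with p hp
  have hp' : (0 : ℝ) < p := by exact_mod_cast hp
  have he : (((p + 1 : ℕ) : ℝ)) ^ (-((n : ℝ) + 1)) = (((p : ℝ) + 1) ^ (n + 1))⁻¹ := by
    rw [Real.rpow_neg (by positivity), ← Nat.cast_add_one n, Real.rpow_natCast]
    push_cast
    rfl
  rw [he, show 1 + 1 / (p : ℝ) = (p + 1) / p by field_simp, div_pow]
  field_simp

lemma IsLaurentA.abs_apply_succ {A : ℕ → ℝ} (hA : IsLaurentA A) (k : ℕ) :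
    |A (k + 1)| = 2 * (2 * (k : ℝ) + 1) * zetaEven (k + 1) / (2 * Real.pi) ^ (2 * (k + 1)) := by
  have hz := zetaEven_nonneg (k + 1)
  have hpi := Real.pi_pos
  rw [hA.apply_succ, abs_neg, abs_div, abs_mul, abs_mul, abs_mul, abs_pow, abs_neg, abs_one,
    one_pow, abs_of_nonneg hz, abs_of_pos (by positivity : (0 : ℝ) < 2 * k + 1),
    abs_of_pos (by positivity : (0 : ℝ) < (2 * Real.pi) ^ (2 * (k + 1))), abs_two, mul_one]

lemma IsLaurentA.neg_one_pow_mul {A : ℕ → ℝ} (hA : IsLaurentA A) (n : ℕ) :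
    (-1 : ℝ) ^ n * A n = |A n| := by
  cases n with
  | zero => simp [hA.1]
  | succ k =>
    have h1 : ((-1 : ℝ) ^ k) ^ 2 = 1 := by rw [← pow_mul, pow_mul', neg_one_sq, one_pow]
    rw [hA.abs_apply_succ, hA.apply_succ, pow_succ]
    linear_combination (2 * (2 * (k : ℝ) + 1) * zetaEven (k + 1) /
      (2 * Real.pi) ^ (2 * (k + 1))) * h1

/-- Proposition 3.4 (odd case): for `α = −(2n−1)`, `n ∈ ℕ₀`, the Taylor coefficients satisfy
`Z_N = 4^{n−1} |A_n| n! N^{−(n+1)} 4^N (1 + o(1))`; moreover `(−1)^n A_n = |A_n|`. -/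
theorem coefficient_asymptotics_odd (n : ℕ) (A : ℕ → ℝ) (hA : IsLaurentA A)
    (Z : ℕ → ℝ) (hZ : IsCoeffSeq (-(2 * (n : ℝ) - 1)) Z) :
    Tendsto (fun N : ℕ => Z N / ((N : ℝ) ^ (-((n : ℝ) + 1)) * 4 ^ N)) atTop
      (nhds ((4 : ℝ) ^ ((n : ℤ) - 1) * |A n| * (n.factorial : ℝ))) ∧
    (-1 : ℝ) ^ n * A n = |A n| := by
  refine ⟨tendsto_div_rpow_of_tendsto_shift n ?_, hA.neg_one_pow_mul n⟩
  cases n with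
  | zero =>
    obtain ⟨κ, hκ⟩ := exists_tendsto_mean
    have hZ' : IsCoeffSeq 1 Z := by
      convert hZ using 1
      norm_num
    have h := tendsto_coeff_one hZ' hκ
    rw [integral_mean_sub_kernel hκ] at h
    simpa [hA.1] using h
  | succ k =>
    have h := tendsto_coeff_neg (Nat.succ_ne_zero k) hZ
    rw [integral_kernel_weight (Nat.succ_ne_zero k)] at h
    refine (congrArg (fun L => Tendsto _ atTop (𝓝 L)) ?_).mp h
    rw [hA.abs_apply_succ, mul_pow, pow_mul 2 2, show ((k + 1 : ℕ) : ℤ) - 1 = (k : ℤ) by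
      push_cast; ring, zpow_natCast]
    have hpi := Real.pi_ne_zero
    push_cast
    field_simp
    ring
end

section
/- Let n ≥ 1 be an integer. Then there exist a real constant ζ and constants C > 0, r_0 > 0 such that for all 0 < r < r_0 the integral ∫_r^∞ (1/(t^{2n−1}·(cosh(2t) − 1)) − L_{n−1}(2t)/t^{2n−1}) dt converges and satisfies |∫_r^∞ (1/(t^{2n−1}(cosh(2t) − 1)) − L_{n−1}(2t)/t^{2n−1}) dt − ζ + 2^{2n−1}·A_n·ln r| ≤ C·r². -/
open MeasureTheory

/-- The Laurent polynomial `L_n(t) = (2/t²)[1 + Σ_{k=1}^n A_k t^{2k}]`. -/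
noncomputable def Lfun (A : ℕ → ℝ) (n : ℕ) (t : ℝ) : ℝ :=
  2 / t ^ 2 * (1 + ∑ k ∈ Finset.range n, A (k + 1) * t ^ (2 * (k + 1)))

/-- A function on `(0, ∞)` that is `c / t + O(t)` near `0` and `O(t⁻²)` near `∞` is integrable on
every `(r, ∞)`, and its integral there is `ζ - c log r + O(r²)`. -/
theorem exists_integral_Ioi_log_asymptotics {f : ℝ → ℝ} {c K M : ℝ}
    (hf : ContinuousOn f (Set.Ioi 0))
    (h_zero : ∀ t, 0 < t → t ≤ 1 → |f t - c / t| ≤ K * t)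
    (h_top : ∀ t, 1 ≤ t → |f t| ≤ M * t ^ (-2 : ℝ)) :
    ∃ ζ C r₀ : ℝ, 0 < C ∧ 0 < r₀ ∧ ∀ r : ℝ, 0 < r → r < r₀ →
      IntegrableOn f (Set.Ioi r) ∧
        |(∫ t in Set.Ioi r, f t) - ζ + c * Real.log r| ≤ C * r ^ 2 := by
  have hK : 0 ≤ K := by simpa using (abs_nonneg _).trans (h_zero 1 one_pos le_rfl)
  have h_int_top : IntegrableOn f (Set.Ioi 1) := by
    refine Integrable.mono'
      ((integrableOn_Ioi_rpow_of_lt (by norm_num : (-2 : ℝ) < -1) one_pos).const_mul M)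
      ((hf.mono (Set.Ioi_subset_Ioi zero_le_one)).aestronglyMeasurable measurableSet_Ioi) ?_
    filter_upwards [ae_restrict_mem measurableSet_Ioi] with t ht
    exact h_top t (le_of_lt ht)
  have hg_cont : ContinuousOn (fun t => f t - c / t) (Set.Ioi 0) :=
    hf.sub (continuousOn_const.div continuousOn_id fun t ht => ne_of_gt ht)
  have hg_int : IntervalIntegrable (fun t => f t - c / t) volume 0 1 := by
    rw [intervalIntegrable_iff_integrableOn_Ioc_of_le zero_le_one]
    refine Integrable.mono' (g := fun _ => K) (integrableOn_const (by simp))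
      ((hg_cont.mono fun t ht => ht.1).aestronglyMeasurable measurableSet_Ioc) ?_
    filter_upwards [ae_restrict_mem measurableSet_Ioc] with t ht
    exact (h_zero t ht.1 ht.2).trans (mul_le_of_le_one_right hK ht.2)
  refine ⟨(∫ t in Set.Ioi 1, f t) + ∫ t in (0 : ℝ)..1, (f t - c / t), K + 1, 1, by linarith,
    one_pos, fun r hr hr1 => ?_⟩
  have hf_int : IntervalIntegrable f volume r 1 := by
    refine (hf.mono ?_).intervalIntegrable
    rw [Set.uIcc_of_le hr1.le]
    exact fun t ht => hr.trans_le ht.1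
  have hf_Ioc : IntegrableOn f (Set.Ioc r 1) :=
    (intervalIntegrable_iff_integrableOn_Ioc_of_le hr1.le).1 hf_int
  have hg_left : IntervalIntegrable (fun t => f t - c / t) volume 0 r :=
    hg_int.mono_set (by
      rw [Set.uIcc_of_le hr.le, Set.uIcc_of_le zero_le_one]
      exact Set.Icc_subset_Icc le_rfl hr1.le)
  have h_inv : IntervalIntegrable (fun t => c / t) volume r 1 := by
    refine ContinuousOn.intervalIntegrable
      (continuousOn_const.div continuousOn_id fun t ht => ?_)
    rw [Set.uIcc_of_le hr1.le] at ht
    exact (hr.trans_le ht.1).ne'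
  have h_split : ∫ t in Set.Ioi r, f t = (∫ t in r..1, f t) + ∫ t in Set.Ioi 1, f t := by
    rw [← Set.Ioc_union_Ioi_eq_Ioi hr1.le,
      setIntegral_union (Set.Ioc_disjoint_Ioi le_rfl) measurableSet_Ioi hf_Ioc h_int_top,
      intervalIntegral.integral_of_le hr1.le]
  have h_log : ∫ t in r..1, c / t = -(c * Real.log r) := by
    simp only [div_eq_mul_inv, intervalIntegral.integral_const_mul,
      integral_inv_of_pos hr one_pos, one_mul, Real.log_inv, mul_neg]
  have h_add := intervalIntegral.integral_add_adjacent_intervals hg_left (hf_int.sub h_inv)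
  have h_sub := intervalIntegral.integral_sub hf_int h_inv
  have h_small : ‖∫ t in (0 : ℝ)..r, (f t - c / t)‖ ≤ K * r * |r - 0| := by
    refine intervalIntegral.norm_integral_le_of_norm_le_const fun t ht => ?_
    rw [Set.uIoc_of_le hr.le] at ht
    exact (h_zero t ht.1 (ht.2.trans hr1.le)).trans (mul_le_mul_of_nonneg_left ht.2 hK)
  refine ⟨?_, ?_⟩
  · rw [← Set.Ioc_union_Ioi_eq_Ioi hr1.le]
    exact hf_Ioc.union h_int_top
  · have h_eq : (∫ t in Set.Ioi r, f t) -
        ((∫ t in Set.Ioi 1, f t) + ∫ t in (0 : ℝ)..1, (f t - c / t)) + c * Real.log r =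
        -∫ t in (0 : ℝ)..r, (f t - c / t) := by
      linarith
    rw [h_eq, abs_neg]
    rw [Real.norm_eq_abs, sub_zero, abs_of_pos hr] at h_small
    nlinarith [sq_nonneg r]

/-- The lower bound `2t² ≤ cosh 2t - 1` for `t ≥ 0`. -/
theorem two_mul_sq_le_cosh_two_mul_sub_one {t : ℝ} (ht : 0 ≤ t) :
    2 * t ^ 2 ≤ Real.cosh (2 * t) - 1 := by
  have h := Real.self_le_sinh_iff.2 ht
  rw [Real.cosh_two_mul, Real.cosh_sq]
  nlinarith

/-- Near `0`, the regularised integrand with `n = m + 1` is `2^{2m+1} A_{m+1} / t + O(t)`. -/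
theorem IsLaurentA.exists_abs_sub_div_le {A : ℕ → ℝ} (hA : IsLaurentA A) (m : ℕ) :
    ∃ K : ℝ, ∀ t, 0 < t → t ≤ 1 →
      |1 / (t ^ (2 * m + 1) * (Real.cosh (2 * t) - 1)) - Lfun A m (2 * t) / t ^ (2 * m + 1) -
        2 ^ (2 * m + 1) * A (m + 1) / t| ≤ K * t := by
  have h_one : Summable fun k : ℕ => |A (k + 1) * (2 * 1) ^ (2 * (k + 1))| :=
    (hA.2 1 one_ne_zero (by rw [abs_one]; linarith [Real.pi_gt_three])).summable.abs
  have h_tail := (summable_nat_add_iff (m + 1)).2 h_one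
  refine ⟨(∑' k, |A (k + (m + 1) + 1) * (2 * 1) ^ (2 * (k + (m + 1) + 1))|) / 2,
    fun t ht ht1 => ?_⟩
  have hS := (hasSum_nat_add_iff' (m + 1)).2
    (hA.2 t ht.ne' (by rw [abs_of_pos ht]; linarith [Real.pi_gt_three]))
  have h_bound := tsum_of_norm_bounded (h_tail.hasSum.mul_right (t ^ (2 * m + 4)))
    (f := fun k => A (k + (m + 1) + 1) * (2 * t) ^ (2 * (k + (m + 1) + 1))) (fun k => by
      rw [Real.norm_eq_abs, mul_pow, mul_one, ← mul_assoc, abs_mul, abs_of_pos (pow_pos ht _)]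
      exact mul_le_mul_of_nonneg_left
        (pow_le_pow_of_le_one ht.le ht1 (by omega)) (abs_nonneg _))
  rw [hS.tsum_eq, Real.norm_eq_abs] at h_bound
  have hc : Real.cosh (2 * t) - 1 ≠ 0 := by
    have := two_mul_sq_le_cosh_two_mul_sub_one ht.le
    have := pow_pos ht 2
    linarith
  have h_eq : 1 / (t ^ (2 * m + 1) * (Real.cosh (2 * t) - 1)) -
      Lfun A m (2 * t) / t ^ (2 * m + 1) - 2 ^ (2 * m + 1) * A (m + 1) / t =
      (2 * t ^ 2 / (Real.cosh (2 * t) - 1) - 1 -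
        ∑ i ∈ Finset.range (m + 1), A (i + 1) * (2 * t) ^ (2 * (i + 1))) /
        (2 * t ^ (2 * m + 3)) := by
    rw [Finset.sum_range_succ, Lfun]
    generalize ∑ i ∈ Finset.range m, A (i + 1) * (2 * t) ^ (2 * (i + 1)) = s
    have ht0 := ht.ne'
    field_simp
    ring
  have hp : 0 < 2 * t ^ (2 * m + 3) := by positivity
  rw [h_eq, abs_div, abs_of_pos hp, div_le_iff₀ hp]
  exact h_bound.trans_eq (by ring)

/-- On `[1, ∞)`, the regularised integrand with `n = m + 1` is `O(t⁻²)`. -/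
theorem exists_abs_le_mul_rpow_neg_two (A : ℕ → ℝ) (m : ℕ) :
    ∃ M : ℝ, ∀ t, 1 ≤ t →
      |1 / (t ^ (2 * m + 1) * (Real.cosh (2 * t) - 1)) - Lfun A m (2 * t) / t ^ (2 * m + 1)| ≤
        M * t ^ (-2 : ℝ) := by
  refine ⟨1 / 2 + (1 + ∑ k ∈ Finset.range m, |A (k + 1)| * 2 ^ (2 * (k + 1))) / 2,
    fun t ht => ?_⟩
  have ht0 : 0 < t := by linarith
  have hp : 1 ≤ t ^ (2 * m + 1) := one_le_pow₀ ht
  have hc := two_mul_sq_le_cosh_two_mul_sub_one ht0.le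
  have ht2 : 0 < 2 * t ^ 2 := by positivity
  have h_rpow : t ^ (-2 : ℝ) = (t ^ 2)⁻¹ := by
    rw [Real.rpow_neg ht0.le, Real.rpow_ofNat]
  have h_cosh : |1 / (t ^ (2 * m + 1) * (Real.cosh (2 * t) - 1))| ≤ 1 / (2 * t ^ 2) := by
    rw [abs_of_nonneg (one_div_nonneg.2 (mul_nonneg (by positivity) (by linarith)))]
    exact one_div_le_one_div_of_le ht2 (by nlinarith)
  have h_sum : |1 + ∑ k ∈ Finset.range m, A (k + 1) * (2 * t) ^ (2 * (k + 1))| ≤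
      (1 + ∑ k ∈ Finset.range m, |A (k + 1)| * 2 ^ (2 * (k + 1))) * t ^ (2 * m + 1) := by
    rw [add_mul, one_mul, Finset.sum_mul]
    refine (abs_add_le _ _).trans (add_le_add (by rwa [abs_one])
      ((Finset.abs_sum_le_sum_abs _ _).trans (Finset.sum_le_sum fun k hk => ?_)))
    have hk := Finset.mem_range.1 hk
    rw [abs_mul, abs_of_pos (by positivity : 0 < (2 * t) ^ (2 * (k + 1))), mul_pow, ← mul_assoc]
    exact mul_le_mul_of_nonneg_left (pow_le_pow_right₀ ht (by omega)) (by positivity)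
  have h_L : |Lfun A m (2 * t) / t ^ (2 * m + 1)| ≤
      (1 + ∑ k ∈ Finset.range m, |A (k + 1)| * 2 ^ (2 * (k + 1))) / (2 * t ^ 2) := by
    rw [Lfun, abs_div, abs_mul, abs_of_pos (by positivity : 0 < 2 / (2 * t) ^ 2),
      abs_of_pos (by positivity : 0 < t ^ (2 * m + 1)), div_le_iff₀ (by positivity)]
    calc _ ≤ _ := mul_le_mul_of_nonneg_left h_sum (by positivity)
      _ = _ := by field_simp
  calc _ ≤ _ := abs_sub _ _
    _ ≤ _ := add_le_add h_cosh h_L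
    _ = _ := by rw [h_rpow]; field_simp

/-- The regularised integrand is continuous on `(0, ∞)`. -/
theorem continuousOn_one_div_sub_Lfun (A : ℕ → ℝ) (m : ℕ) :
    ContinuousOn (fun t : ℝ => 1 / (t ^ (2 * m + 1) * (Real.cosh (2 * t) - 1)) -
      Lfun A m (2 * t) / t ^ (2 * m + 1)) (Set.Ioi 0) := by
  intro t ht
  have ht : 0 < t := ht
  have hc : Real.cosh (2 * t) - 1 ≠ 0 := by
    have := two_mul_sq_le_cosh_two_mul_sub_one ht.le
    have := pow_pos ht 2
    linarith
  have hp : t ^ (2 * m + 1) ≠ 0 := by positivity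
  have hq : (2 * t) ^ 2 ≠ 0 := by positivity
  have hpc := mul_ne_zero hp hc
  have h_cosh : Continuous fun t : ℝ => Real.cosh (2 * t) :=
    Real.continuous_cosh.comp (continuous_const_mul 2)
  unfold Lfun
  exact ContinuousAt.continuousWithinAt (by fun_prop (disch := assumption))

/-- For `n ≥ 1` there exist a constant `ζ` and `C, r₀ > 0` such that for `0 < r < r₀`, the
integral `∫_r^∞ (1/(t^{2n−1}(cosh 2t − 1)) − L_{n−1}(2t)/t^{2n−1}) dt` converges and equals
`ζ − 2^{2n−1} A_n ln r + O(r²)`. -/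
theorem log_integral_asymptotics (n : ℕ) (hn : 1 ≤ n) (A : ℕ → ℝ) (hA : IsLaurentA A) :
    ∃ ζ C r₀ : ℝ, 0 < C ∧ 0 < r₀ ∧
      ∀ r : ℝ, 0 < r → r < r₀ →
        IntegrableOn
          (fun t : ℝ => 1 / (t ^ (2 * n - 1) * (Real.cosh (2 * t) - 1)) -
            Lfun A (n - 1) (2 * t) / t ^ (2 * n - 1)) (Set.Ioi r) ∧
        |(∫ t in Set.Ioi r,
            (1 / (t ^ (2 * n - 1) * (Real.cosh (2 * t) - 1)) -
              Lfun A (n - 1) (2 * t) / t ^ (2 * n - 1)) : ℝ) -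
            ζ + 2 ^ (2 * n - 1) * A n * Real.log r| ≤ C * r ^ 2 := by
  obtain ⟨m, rfl⟩ : ∃ m, n = m + 1 := ⟨n - 1, by omega⟩
  rw [show 2 * (m + 1) - 1 = 2 * m + 1 by omega, Nat.add_sub_cancel]
  obtain ⟨K, hK⟩ := hA.exists_abs_sub_div_le m
  obtain ⟨M, hM⟩ := exists_abs_le_mul_rpow_neg_two A m
  exact exists_integral_Ioi_log_asymptotics (continuousOn_one_div_sub_Lfun A m) hK hM
end

section
/- For every fixed real α, the power series Σ_{N≥1} Z_N g^N, where Z_N = Σ_{T ∈ 𝒯_N} h(T)^α, has radius of convergence exactly 1/4: it converges for all complex g with |g| < 1/4 and diverges for real g > 1/4. -/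
/-- A rooted planar tree with root of degree one, encoded à la Neveu: the vertex set is a set
of finite words over `ℕ`, containing the empty word (the root), closed under prefixes and
under taking earlier siblings, locally finite, and such that the root has exactly one child.
Finite and infinite (locally finite) trees are both allowed. -/
structure PlaneTree where
  verts : Set (List ℕ)
  root_mem : ([] : List ℕ) ∈ verts
  prefix_closed : ∀ (w : List ℕ) (k : ℕ), w ++ [k] ∈ verts → w ∈ verts
  sibling_closed : ∀ (w : List ℕ) (k j : ℕ), w ++ [k] ∈ verts → j < k → w ++ [j] ∈ verts
  locally_finite : ∀ w : List ℕ, {k : ℕ | w ++ [k] ∈ verts}.Finite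
  root_child : [0] ∈ verts
  root_degree_one : [1] ∉ verts

namespace PlaneTree

/-- The size `|T|` of a tree: its number of vertices. -/
noncomputable def size (T : PlaneTree) : ℕ := T.verts.ncard

/-- The height `h(T)` of a tree: the maximal distance from the root to a vertex. -/
noncomputable def height (T : PlaneTree) : ℕ := sSup (List.length '' T.verts)

end PlaneTree

/-- The total weight `Z_N = Σ_{T ∈ 𝒯_N} h(T)^α` of trees with `N` vertices. -/
noncomputable def Zpart (α : ℝ) (N : ℕ) : ℝ :=
  ∑' T : {T : PlaneTree // T.verts.Finite ∧ T.size = N}, ((T.1.height : ℝ)) ^ α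

/-- The shift of the first letter of a word, which makes room for a new first tree in a forest. -/
def shiftHead : List ℕ → List ℕ
  | [] => []
  | k :: u => (k + 1) :: u

theorem shiftHead_injective : Function.Injective shiftHead := by
  rintro (_ | ⟨k, u⟩) (_ | ⟨j, v⟩) h <;> simp_all [shiftHead]

theorem shiftHead_append {w : List ℕ} (hw : w ≠ []) (v : List ℕ) :
    shiftHead (w ++ v) = shiftHead w ++ v := by
  cases w with
  | nil => exact absurd rfl hw
  | cons k u => rfl

/-- The nonempty words coding the plane forest attached to a binary tree by the rotation
correspondence: the left subtree codes the children of the first root, the right subtree codes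
the remaining trees of the forest. -/
def forestWords : BinaryTree Unit → Finset (List ℕ)
  | .nil => ∅
  | .node _ l r =>
    insert [0] ((forestWords l).image (List.cons 0) ∪ (forestWords r).image shiftHead)

theorem nil_notMem_forestWords (t : BinaryTree Unit) : [] ∉ forestWords t := by
  induction t with
  | nil => simp [forestWords]
  | node a l r _ ihr =>
    simp only [forestWords, Finset.mem_insert, Finset.mem_union, Finset.mem_image, not_or]
    refine ⟨by simp, by simp, ?_⟩
    rintro ⟨_ | ⟨k, u⟩, hw, h⟩
    · exact ihr hw
    · simp [shiftHead] at h

theorem zero_cons_mem_forestWords_node {a : Unit} {l r : BinaryTree Unit} {w : List ℕ} :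
    0 :: w ∈ forestWords (.node a l r) ↔ w = [] ∨ w ∈ forestWords l := by
  have h : ∀ v, shiftHead v ≠ 0 :: w := by rintro (_ | ⟨k, u⟩) <;> simp [shiftHead]
  simp [forestWords, h]

theorem succ_cons_mem_forestWords_node {a : Unit} {l r : BinaryTree Unit} {k : ℕ} {w : List ℕ} :
    (k + 1) :: w ∈ forestWords (.node a l r) ↔ k :: w ∈ forestWords r := by
  have h : (k + 1) :: w = shiftHead (k :: w) := rfl
  have h' : ∀ v : List ℕ, 0 :: v ≠ shiftHead (k :: w) := by simp [shiftHead]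
  rw [h]
  simp only [forestWords, Finset.mem_insert, Finset.mem_union, Finset.mem_image,
    shiftHead_injective.eq_iff, (h' _).symm, h', exists_eq_right, and_false, exists_false, false_or]

theorem card_forestWords (t : BinaryTree Unit) : (forestWords t).card = t.numNodes := by
  induction t with
  | nil => rfl
  | node a l r ihl ihr =>
    have hdisj : Disjoint ((forestWords l).image (List.cons 0))
        ((forestWords r).image shiftHead) := by
      simp only [Finset.disjoint_left, Finset.mem_image, not_exists, not_and]
      rintro _ ⟨w, _, rfl⟩ (_ | ⟨k, u⟩) _ <;> simp [shiftHead]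
    have hnot : [0] ∉ (forestWords l).image (List.cons 0) ∪ (forestWords r).image shiftHead := by
      simp only [Finset.mem_union, Finset.mem_image, not_or, not_exists, not_and]
      refine ⟨fun w hw h => ?_, ?_⟩
      · obtain rfl : w = [] := by simpa using h
        exact nil_notMem_forestWords l hw
      · rintro (_ | ⟨k, u⟩) _ <;> simp [shiftHead]
    rw [forestWords, Finset.card_insert_of_notMem hnot, Finset.card_union_of_disjoint hdisj,
      Finset.card_image_of_injective _ List.cons_injective,
      Finset.card_image_of_injective _ shiftHead_injective, ihl, ihr, BinaryTree.numNodes]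

theorem length_le_numNodes_of_mem_forestWords {t : BinaryTree Unit} {w : List ℕ}
    (hw : w ∈ forestWords t) : w.length ≤ t.numNodes := by
  induction t generalizing w with
  | nil => simp [forestWords] at hw
  | node a l r ihl ihr =>
    rw [BinaryTree.numNodes]
    match w with
    | [] => simp
    | 0 :: u =>
      rcases zero_cons_mem_forestWords_node.1 hw with rfl | hu
      · simp
      · have := ihl hu
        simp only [List.length_cons]
        omega
    | (k + 1) :: u =>
      have := ihr (succ_cons_mem_forestWords_node.1 hw)
      simp only [List.length_cons] at this ⊢
      omega

theorem forestWords_injective : Function.Injective forestWords := by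
  intro s
  induction s with
  | nil =>
    rintro (_ | ⟨a, l, r⟩) h
    · rfl
    · have : [0] ∈ forestWords .nil := h ▸ zero_cons_mem_forestWords_node.2 (.inl rfl)
      simp [forestWords] at this
  | node a l r ihl ihr =>
    rintro (_ | ⟨b, l', r'⟩) h
    · have : [0] ∈ forestWords .nil := h ▸ zero_cons_mem_forestWords_node.2 (.inl rfl)
      simp [forestWords] at this
    · have hl : l = l' := by
        refine ihl (Finset.ext fun w => ?_)
        by_cases hw : w = []
        · simp [hw, nil_notMem_forestWords]
        · have := zero_cons_mem_forestWords_node (a := a) (l := l) (r := r) (w := w)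
          rw [h, zero_cons_mem_forestWords_node] at this
          simpa [hw] using this.symm
      have hr : r = r' := by
        refine ihr (Finset.ext fun w => ?_)
        match w with
        | [] => simp [nil_notMem_forestWords]
        | k :: u =>
          rw [← succ_cons_mem_forestWords_node (a := a) (l := l), h,
            succ_cons_mem_forestWords_node]
      rw [hl, hr]

/-- A finite set of nonempty words coding a plane forest. -/
structure IsForest (S : Finset (List ℕ)) : Prop where
  nil_notMem : [] ∉ S
  prefix_closed : ∀ (w : List ℕ) (k : ℕ), w ≠ [] → w ++ [k] ∈ S → w ∈ S
  sibling_closed : ∀ (w : List ℕ) (k j : ℕ), w ++ [k] ∈ S → j < k → w ++ [j] ∈ S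

theorem isForest_forestWords (t : BinaryTree Unit) : IsForest (forestWords t) := by
  refine ⟨nil_notMem_forestWords t, ?_, ?_⟩
  · induction t with
    | nil => simp [forestWords]
    | node a l r ihl ihr =>
      intro w k hw h
      match w with
      | [] => exact absurd rfl hw
      | 0 :: u =>
        rw [List.cons_append, zero_cons_mem_forestWords_node] at h
        rw [zero_cons_mem_forestWords_node]
        by_cases hu : u = []
        · exact .inl hu
        · exact .inr (ihl u k hu (h.resolve_left (by simp)))
      | (i + 1) :: u =>
        rw [List.cons_append, succ_cons_mem_forestWords_node] at h
        rw [succ_cons_mem_forestWords_node]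
        exact ihr (i :: u) k (by simp) h
  · induction t with
    | nil => simp [forestWords]
    | node a l r ihl ihr =>
      intro w k j h hjk
      match w, k, j with
      | [], k, 0 => exact zero_cons_mem_forestWords_node.2 (.inl rfl)
      | [], k + 1, j + 1 =>
        exact succ_cons_mem_forestWords_node.2
          (ihr [] k j (succ_cons_mem_forestWords_node.1 h) (by omega))
      | 0 :: u, k, j =>
        rw [List.cons_append, zero_cons_mem_forestWords_node] at h ⊢
        exact .inr (ihl u k j (h.resolve_left (by simp)) hjk)
      | (i + 1) :: u, k, j =>
        rw [List.cons_append, succ_cons_mem_forestWords_node] at h ⊢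
        exact ihr (i :: u) k j h hjk

namespace IsForest

variable {S : Finset (List ℕ)}

theorem zero_mem (hS : IsForest S) (hne : S.Nonempty) : [0] ∈ S := by
  obtain ⟨w, hw⟩ := hne
  induction w using List.reverseRecOn with
  | nil => exact absurd hw hS.nil_notMem
  | append_singleton u k ih =>
    by_cases hu : u = []
    · subst hu
      rcases Nat.eq_zero_or_pos k with rfl | hk
      · exact hw
      · exact hS.sibling_closed [] k 0 hw hk
    · exact ih (hS.prefix_closed u k hu hw)

/-- The forest of descendants of the first root. -/
theorem firstChildren (hS : IsForest S) :
    IsForest ((S.preimage (List.cons 0) List.cons_injective.injOn).erase []) := by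
  refine ⟨by simp, fun w k hw h => ?_, fun w k j h hjk => ?_⟩
  · simp only [Finset.mem_erase, Finset.mem_preimage] at h ⊢
    exact ⟨hw, hS.prefix_closed (0 :: w) k (by simp) h.2⟩
  · simp only [Finset.mem_erase, Finset.mem_preimage] at h ⊢
    exact ⟨by simp, hS.sibling_closed (0 :: w) k j h.2 hjk⟩

/-- The forest obtained by removing the first tree. -/
theorem tail (hS : IsForest S) :
    IsForest (S.preimage shiftHead shiftHead_injective.injOn) := by
  refine ⟨by simpa [shiftHead] using hS.nil_notMem, fun w k hw h => ?_, fun w k j h hjk => ?_⟩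
  · simp only [Finset.mem_preimage] at h ⊢
    rw [shiftHead_append hw] at h
    refine hS.prefix_closed _ k (fun h0 => hw ?_) h
    exact shiftHead_injective (h0.trans rfl)
  · simp only [Finset.mem_preimage] at h ⊢
    by_cases hw : w = []
    · subst hw
      exact hS.sibling_closed [] (k + 1) (j + 1) h (by omega)
    · rw [shiftHead_append hw] at h ⊢
      exact hS.sibling_closed _ k j h hjk

theorem exists_forestWords_eq (hS : IsForest S) : ∃ t, forestWords t = S := by
  induction hn : S.card using Nat.strong_induction_on generalizing S with
  | _ n ih =>
    rcases S.eq_empty_or_nonempty with rfl | hne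
    · exact ⟨.nil, rfl⟩
    have h0 := hS.zero_mem hne
    have hlt : ∀ (f : List ℕ → List ℕ) (hf : f.Injective) (R : Finset (List ℕ)),
        (∀ w ∈ R, f w ∈ S ∧ f w ≠ [0]) → R.card < n := by
      intro f hf R hR
      rw [← hn, ← Finset.card_image_of_injective R hf]
      refine Finset.card_lt_card (Finset.ssubset_iff_of_subset ?_ |>.2 ⟨[0], h0, ?_⟩)
      · intro v hv
        obtain ⟨w, hw, rfl⟩ := Finset.mem_image.1 hv
        exact (hR w hw).1
      · intro hv
        obtain ⟨w, hw, h⟩ := Finset.mem_image.1 hv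
        exact (hR w hw).2 h
    obtain ⟨l, hl⟩ := ih _ (hlt (List.cons 0) List.cons_injective _ (by
      intro w hw
      simp only [Finset.mem_erase, Finset.mem_preimage] at hw
      simpa using hw.symm)) hS.firstChildren rfl
    obtain ⟨r, hr⟩ := ih _ (hlt _ shiftHead_injective _ (by
      intro w hw
      refine ⟨Finset.mem_preimage.1 hw, ?_⟩
      cases w <;> simp [shiftHead])) hS.tail rfl
    refine ⟨.node () l r, Finset.ext fun w => ?_⟩
    match w with
    | [] => simp [nil_notMem_forestWords, hS.nil_notMem]
    | 0 :: u =>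
      rw [zero_cons_mem_forestWords_node, hl]
      by_cases hu : u = [] <;> simp [hu, h0]
    | (k + 1) :: u =>
      rw [succ_cons_mem_forestWords_node, hr, Finset.mem_preimage, shiftHead]

end IsForest

namespace PlaneTree

theorem verts_injective : Function.Injective verts := by
  rintro ⟨⟩ ⟨⟩ h
  cases h
  rfl

/-- The plane tree whose root has a single child, above which sits the forest coded by `t`. -/
def ofBinaryTree (t : BinaryTree Unit) : PlaneTree where
  verts := insert [] (forestWords (.node () t .nil) : Set (List ℕ))
  root_mem := Set.mem_insert _ _
  prefix_closed w k h := by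
    by_cases hw : w = []
    · exact .inl hw
    · exact .inr ((isForest_forestWords _).prefix_closed w k hw (h.resolve_left (by simp)))
  sibling_closed w k j h hjk :=
    .inr ((isForest_forestWords _).sibling_closed w k j (h.resolve_left (by simp)) hjk)
  locally_finite w :=
    (((Finset.finite_toSet _).insert []).preimage (by intro a _ b _ h; simpa using h) :
      ((fun k : ℕ => w ++ [k]) ⁻¹' _).Finite)
  root_child := .inr (zero_cons_mem_forestWords_node.2 (.inl rfl))
  root_degree_one h := by
    have := succ_cons_mem_forestWords_node.1 (h.resolve_left (by simp) :
      [0 + 1] ∈ forestWords (.node () t .nil))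
    simp [forestWords] at this

theorem verts_ofBinaryTree (t : BinaryTree Unit) :
    (ofBinaryTree t).verts = insert [] (forestWords (.node () t .nil) : Set (List ℕ)) := rfl

theorem finite_verts_ofBinaryTree (t : BinaryTree Unit) : (ofBinaryTree t).verts.Finite :=
  (Finset.finite_toSet _).insert []

theorem size_ofBinaryTree (t : BinaryTree Unit) : (ofBinaryTree t).size = t.numNodes + 2 := by
  rw [size, verts_ofBinaryTree,
    Set.ncard_insert_of_notMem (by simpa using nil_notMem_forestWords _), Set.ncard_coe_finset,
    card_forestWords]
  simp [BinaryTree.numNodes]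

theorem ofBinaryTree_injective : Function.Injective ofBinaryTree := by
  intro s t h
  have hv := congrArg verts h
  rw [verts_ofBinaryTree, verts_ofBinaryTree] at hv
  have hw : forestWords (.node () s .nil) = forestWords (.node () t .nil) := by
    ext w
    by_cases hw : w = []
    · simp [hw, nil_notMem_forestWords]
    · simpa [hw] using Set.ext_iff.1 hv w
  injection forestWords_injective hw

theorem exists_ofBinaryTree_eq {T : PlaneTree} (hT : T.verts.Finite) :
    ∃ t, ofBinaryTree t = T := by
  have hF : IsForest (hT.toFinset.erase []) := by
    refine ⟨by simp, fun w k hw h => ?_, fun w k j h hjk => ?_⟩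
    · simp only [Finset.mem_erase, Set.Finite.mem_toFinset] at h ⊢
      exact ⟨hw, T.prefix_closed w k h.2⟩
    · simp only [Finset.mem_erase, Set.Finite.mem_toFinset] at h ⊢
      exact ⟨by simp, T.sibling_closed w k j h.2 hjk⟩
  obtain ⟨t, ht⟩ := hF.exists_forestWords_eq
  match t with
  | .nil =>
    have : [0] ∈ forestWords .nil := by simpa [ht] using T.root_child
    simp [forestWords] at this
  | .node a l r =>
    have hr : forestWords r = ∅ := by
      by_contra hne
      have h0 := (isForest_forestWords r).zero_mem (Finset.nonempty_iff_ne_empty.2 hne)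
      have h1 := succ_cons_mem_forestWords_node (a := a) (l := l) |>.2 h0
      rw [ht] at h1
      exact T.root_degree_one (by simpa using h1)
    obtain rfl : r = .nil := forestWords_injective hr
    refine ⟨l, verts_injective ?_⟩
    rw [verts_ofBinaryTree, ht]
    ext w
    by_cases hw : w = []
    · simp [hw, T.root_mem]
    · simp [hw]

theorem one_le_height_ofBinaryTree (t : BinaryTree Unit) : 1 ≤ (ofBinaryTree t).height :=
  le_csSup ((finite_verts_ofBinaryTree t).image _).bddAbove
    ⟨[0], (ofBinaryTree t).root_child, rfl⟩

theorem height_ofBinaryTree_le (t : BinaryTree Unit) :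
    (ofBinaryTree t).height ≤ t.numNodes + 1 := by
  refine csSup_le' ?_
  rintro _ ⟨w, rfl | hw, rfl⟩
  · simp
  · simpa [BinaryTree.numNodes] using length_le_numNodes_of_mem_forestWords hw

/-- Finite plane trees with `n + 2` vertices correspond to binary trees with `n` nodes. -/
noncomputable def binaryTreeEquiv (n : ℕ) :
    BinaryTree.treesOfNumNodesEq n ≃ {T : PlaneTree // T.verts.Finite ∧ T.size = n + 2} :=
  Equiv.ofBijective
    (fun t => ⟨ofBinaryTree t, finite_verts_ofBinaryTree _, by
      rw [size_ofBinaryTree, BinaryTree.mem_treesOfNumNodesEq.1 t.2]⟩) <| by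
    refine ⟨fun s t h => Subtype.ext (ofBinaryTree_injective (congrArg Subtype.val h)), ?_⟩
    rintro ⟨T, hT, hn⟩
    obtain ⟨t, rfl⟩ := exists_ofBinaryTree_eq hT
    rw [size_ofBinaryTree] at hn
    exact ⟨⟨t, BinaryTree.mem_treesOfNumNodesEq.2 (by omega)⟩, rfl⟩

theorem two_le_size {T : PlaneTree} (hT : T.verts.Finite) : 2 ≤ T.size := by
  obtain ⟨t, rfl⟩ := exists_ofBinaryTree_eq hT
  rw [size_ofBinaryTree]
  omega

end PlaneTree

open PlaneTree

theorem Zpart_add_two (α : ℝ) (n : ℕ) :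
    Zpart α (n + 2) =
      ∑ t ∈ BinaryTree.treesOfNumNodesEq n, ((ofBinaryTree t).height : ℝ) ^ α := by
  rw [Zpart, ← (binaryTreeEquiv n).tsum_eq]
  exact Finset.tsum_subtype (BinaryTree.treesOfNumNodesEq n)
    fun t => ((ofBinaryTree t).height : ℝ) ^ α

theorem Zpart_one (α : ℝ) : Zpart α 1 = 0 := by
  have : IsEmpty {T : PlaneTree // T.verts.Finite ∧ T.size = 1} :=
    ⟨fun T => by have := two_le_size T.2.1; have := T.2.2; omega⟩
  exact tsum_empty

theorem Zpart_nonneg (α : ℝ) (n : ℕ) : 0 ≤ Zpart α n :=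
  tsum_nonneg fun _ => Real.rpow_nonneg (Nat.cast_nonneg _) _

theorem Zpart_le {α : ℝ} {m : ℕ} (hm : |α| ≤ m) (n : ℕ) :
    Zpart α (n + 1) ≤ 4 ^ (n + 1) * ((n + 1 : ℕ) : ℝ) ^ m := by
  rcases n with _ | n
  · rw [Zpart_one]
    positivity
  have hterm : ∀ t ∈ BinaryTree.treesOfNumNodesEq n,
      ((ofBinaryTree t).height : ℝ) ^ α ≤ ((n + 1 + 1 : ℕ) : ℝ) ^ m := by
    intro t ht
    have h1 : (1 : ℝ) ≤ (ofBinaryTree t).height := by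
      exact_mod_cast one_le_height_ofBinaryTree t
    have h2 := height_ofBinaryTree_le t
    rw [BinaryTree.mem_treesOfNumNodesEq.1 ht] at h2
    calc ((ofBinaryTree t).height : ℝ) ^ α ≤ ((ofBinaryTree t).height : ℝ) ^ (m : ℝ) :=
          Real.rpow_le_rpow_of_exponent_le h1 ((le_abs_self α).trans hm)
      _ = ((ofBinaryTree t).height : ℝ) ^ m := Real.rpow_natCast _ _
      _ ≤ _ := by
          gcongr
          omega
  have hcat : (catalan n : ℝ) ≤ 4 ^ (n + 1 + 1) := by
    have h1 : catalan n ≤ 4 ^ n := by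
      calc catalan n ≤ (n + 1) * catalan n := Nat.le_mul_of_pos_left _ n.succ_pos
        _ = n.centralBinom := succ_mul_catalan_eq_centralBinom n
        _ ≤ 4 ^ n := Nat.centralBinom_le_four_pow n
    have h2 : 4 ^ n ≤ 4 ^ (n + 1 + 1) := Nat.pow_le_pow_right (by norm_num) (by omega)
    exact_mod_cast h1.trans h2
  rw [Zpart_add_two]
  refine (Finset.sum_le_card_nsmul _ _ _ hterm).trans ?_
  rw [BinaryTree.treesOfNumNodesEq_card_eq_catalan, nsmul_eq_mul]
  gcongr

theorem four_pow_le_Zpart {α : ℝ} {m : ℕ} (hm : |α| ≤ m) {n : ℕ} (hn : 0 < n) :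
    (4 : ℝ) ^ n ≤ 2 * ((n + 2 : ℕ) : ℝ) ^ (m + 2) * Zpart α (n + 2) := by
  have hterm : ∀ t ∈ BinaryTree.treesOfNumNodesEq n,
      (((n + 2 : ℕ) : ℝ) ^ m)⁻¹ ≤ ((ofBinaryTree t).height : ℝ) ^ α := by
    intro t ht
    have h1 : (1 : ℝ) ≤ (ofBinaryTree t).height := by
      exact_mod_cast one_le_height_ofBinaryTree t
    have h2 := height_ofBinaryTree_le t
    rw [BinaryTree.mem_treesOfNumNodesEq.1 ht] at h2
    calc (((n + 2 : ℕ) : ℝ) ^ m)⁻¹ ≤ (((ofBinaryTree t).height : ℝ) ^ m)⁻¹ := by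
          gcongr
          omega
      _ = ((ofBinaryTree t).height : ℝ) ^ (-(m : ℝ)) := by
          rw [Real.rpow_neg (by positivity), Real.rpow_natCast]
      _ ≤ _ := Real.rpow_le_rpow_of_exponent_le h1 (by linarith [neg_abs_le α])
  have hsum := Finset.card_nsmul_le_sum _ _ _ hterm
  rw [← Zpart_add_two, BinaryTree.treesOfNumNodesEq_card_eq_catalan, nsmul_eq_mul] at hsum
  have hcat : (4 : ℝ) ^ n ≤ 2 * ((n + 2 : ℕ) : ℝ) ^ 2 * catalan n := by
    have h1 : 4 ^ n ≤ 2 * (n + 2) ^ 2 * catalan n := by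
      calc 4 ^ n ≤ 2 * n * n.centralBinom := Nat.four_pow_le_two_mul_self_mul_centralBinom n hn
        _ = 2 * (n * (n + 1)) * catalan n := by
            rw [← succ_mul_catalan_eq_centralBinom]
            ring
        _ ≤ _ := by
            gcongr
            nlinarith
    exact_mod_cast h1
  calc (4 : ℝ) ^ n ≤ 2 * ((n + 2 : ℕ) : ℝ) ^ 2 * catalan n := hcat
    _ = 2 * ((n + 2 : ℕ) : ℝ) ^ (m + 2) * (catalan n * (((n + 2 : ℕ) : ℝ) ^ m)⁻¹) := by
        have : ((n + 2 : ℕ) : ℝ) ^ m ≠ 0 := by positivity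
        field_simp
        ring
    _ ≤ _ := by gcongr

/-- For every real `α`, the power series `Σ_{N≥1} Z_N g^N` has radius of convergence exactly
`1/4`: it converges for every complex `g` with `|g| < 1/4` and diverges for real `g > 1/4`. -/
theorem Zpart_radius_of_convergence (α : ℝ) :
    (∀ g : ℂ, ‖g‖ < 1 / 4 →
      Summable (fun N : ℕ => ((Zpart α (N + 1) : ℝ) : ℂ) * g ^ (N + 1))) ∧
    (∀ g : ℝ, 1 / 4 < g → ¬ Summable (fun N : ℕ => Zpart α (N + 1) * g ^ (N + 1))) := by
  obtain ⟨m, hm⟩ := exists_nat_ge |α|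
  refine ⟨fun g hg => ?_, fun g hg hsum => ?_⟩
  · have hr : ‖4 * ‖g‖‖ < 1 := by
      rw [Real.norm_of_nonneg (by positivity)]
      linarith
    refine .of_norm_bounded
      ((summable_nat_add_iff 1).2 (summable_pow_mul_geometric_of_norm_lt_one m hr)) fun n => ?_
    rw [norm_mul, norm_pow, Complex.norm_real, Real.norm_of_nonneg (Zpart_nonneg α _), mul_pow]
    calc Zpart α (n + 1) * ‖g‖ ^ (n + 1)
        ≤ 4 ^ (n + 1) * ((n + 1 : ℕ) : ℝ) ^ m * ‖g‖ ^ (n + 1) := by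
          gcongr
          exact Zpart_le hm n
      _ = _ := by ring
  · have hg0 : 0 < g := by linarith
    have hr : ‖(4 * g)⁻¹‖ < 1 := by
      rw [Real.norm_of_nonneg (by positivity)]
      exact inv_lt_one_of_one_lt₀ (by linarith)
    have hpoly := (Filter.tendsto_add_atTop_iff_nat 2).2
      (summable_pow_mul_geometric_of_norm_lt_one (m + 2) hr).tendsto_atTop_zero
    have hZ := (Filter.tendsto_add_atTop_iff_nat 1).2 hsum.tendsto_atTop_zero
    obtain ⟨n, ⟨hn1, hn2⟩, hn⟩ := ((hZ.eventually (gt_mem_nhds one_pos)).and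
      (hpoly.eventually (gt_mem_nhds (by norm_num : (0 : ℝ) < 1 / 32)))).and
      (Filter.eventually_gt_atTop 0) |>.exists
    have hlow := four_pow_le_Zpart hm hn
    have hprod : 0 < (4 * g) ^ (n + 2) := by positivity
    rw [inv_pow, ← div_eq_mul_inv, div_lt_iff₀ hprod] at hn2
    have : (4 * g) ^ (n + 2) ≤
        16 * (2 * ((n + 2 : ℕ) : ℝ) ^ (m + 2)) * (Zpart α (n + 2) * g ^ (n + 2)) := by
      calc (4 * g) ^ (n + 2) = 16 * 4 ^ n * g ^ (n + 2) := by ring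
        _ ≤ 16 * (2 * ((n + 2 : ℕ) : ℝ) ^ (m + 2) * Zpart α (n + 2)) * g ^ (n + 2) := by gcongr
        _ = _ := by ring
    have hP : (0 : ℝ) < 16 * (2 * ((n + 2 : ℕ) : ℝ) ^ (m + 2)) := by positivity
    have := this.trans_lt (mul_lt_mul_of_pos_left hn1 hP)
    linarith
end
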